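/- arXiv:2507.17890 — 2 statements merged into one kernel-verified Lean document; each statement's English description precedes it below -/
import Mathlib

section
/- Let k, m ∈ ℤ_{>0} with k ≤ m−1, let ε ∈ ℝ_{>0} satisfy L^-_{k,m} ≤ ε, and let ψ_A, ψ_B, ψ_C : U → Mat_{m×m}(ℂ) be differentiable maps defined on a nonempty Euclidean open set U ⊆ V_{m,ε}. Then there exists a point p̄ ∈ U such that dim(P^{p̄} + Q^{p̄}) ≥ m²(mμ − max{3k, mε}). -/
/-- `μ₁(α,β,γ) = (α+β+γ)/3 + (1−α)(1−β)(1−γ)`. -/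
noncomputable def mu1 (a b g : ℝ) : ℝ := (a + b + g) / 3 + (1 - a) * (1 - b) * (1 - g)

/-- `μ₂(α,β,γ)`. -/
noncomputable def mu2 (a b g : ℝ) : ℝ :=
  (1 - a) * (1 - b) * (1 - g) + a * (1 - b) * (1 - g) + b * (1 - a) * (1 - g)
    + g * (1 - a) * (1 - b)
    + max 0 (a * b * (1 - g) - 2 / 3 * min a b)
    + max 0 (a * g * (1 - b) - 2 / 3 * min a g)
    + max 0 (b * g * (1 - a) - 2 / 3 * min b g)

/-- `μ = min_{(α,β,γ)∈[0,1]³} max{μ₁(α,β,γ), μ₂(α,β,γ)}`. -/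
noncomputable def muMin : ℝ :=
  sInf {x : ℝ | ∃ a ∈ Set.Icc (0 : ℝ) 1, ∃ b ∈ Set.Icc (0 : ℝ) 1, ∃ g ∈ Set.Icc (0 : ℝ) 1,
    x = max (mu1 a b g) (mu2 a b g)}

/-- `L⁻_{k,m}`. -/
noncomputable def Lminus (k m : ℕ) : ℝ :=
  max (9 / ((k : ℝ) + 1) -
      ((6 * (k : ℝ) - 2) * (m : ℝ) ^ 2 - (9 * (k : ℝ) ^ 2 + 9) * (m : ℝ)
          + (3 * (k : ℝ) ^ 3 + 9 * (k : ℝ) + 6)) /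
        ((m : ℝ) ^ 2 * (3 * (m : ℝ) - 3 * (k : ℝ) - 2)))
    ((2 * (m : ℝ) ^ 2 + 9 * (m : ℝ) - 6) / ((m : ℝ) ^ 2 * (3 * (m : ℝ) - 2)))

/-- `r_{m,ε} = ⌈(1+ε)m²/3⌉`. -/
noncomputable def rme (m : ℕ) (ε : ℝ) : ℕ := ⌈(1 + ε) * (m : ℝ) ^ 2 / 3⌉₊

/-- Application of an `m × m` matrix to a vector. -/
noncomputable def apMat {m : ℕ} (Φ : Fin m → Fin m → ℂ) (v : Fin m → ℂ) : Fin m → ℂ :=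
  fun i => ∑ j, Φ i j * v j

/-- The subspace `𝒫^p ⊆ (ℂ^m)^{⊗3}`. -/
noncomputable def Psp {m r : ℕ} (x y z : Fin r → Fin m → ℂ)
    (ΨA ΨB ΨC : Fin m → Fin m → ℂ) : Submodule ℂ (Fin m × Fin m × Fin m → ℂ) :=
  Submodule.span ℂ
    ({t | ∃ (v : Fin m → ℂ) (α : Fin r),
        t = fun p => apMat ΨA v p.1 * y α p.2.1 * z α p.2.2} ∪
     {t | ∃ (v : Fin m → ℂ) (α : Fin r),
        t = fun p => x α p.1 * apMat ΨB v p.2.1 * z α p.2.2} ∪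
     {t | ∃ (v : Fin m → ℂ) (α : Fin r),
        t = fun p => x α p.1 * y α p.2.1 * apMat ΨC v p.2.2})

/-- The subspace `𝒬^p ⊆ (ℂ^m)^{⊗3}`. -/
noncomputable def Qsp {m r : ℕ} (x y z ξ η τ : Fin r → Fin m → ℂ)
    (ΨA ΨB ΨC : Fin m → Fin m → ℂ) : Submodule ℂ (Fin m × Fin m × Fin m → ℂ) :=
  Submodule.span ℂ
    ({t | ∃ (q : Fin m → ℂ) (α : Fin r), t = fun p =>
        q p.1 * y α p.2.1 * z α p.2.2 + q p.1 * apMat ΨB (η α) p.2.1 * z α p.2.2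
          + q p.1 * y α p.2.1 * apMat ΨC (τ α) p.2.2} ∪
     {t | ∃ (q : Fin m → ℂ) (α : Fin r), t = fun p =>
        x α p.1 * q p.2.1 * z α p.2.2 + apMat ΨA (ξ α) p.1 * q p.2.1 * z α p.2.2
          + x α p.1 * q p.2.1 * apMat ΨC (τ α) p.2.2} ∪
     {t | ∃ (q : Fin m → ℂ) (α : Fin r), t = fun p =>
        x α p.1 * y α p.2.1 * q p.2.2 + apMat ΨA (ξ α) p.1 * y α p.2.1 * q p.2.2
          + x α p.1 * apMat ΨB (η α) p.2.1 * q p.2.2})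

open scoped IntermediateField.algebraAdjoinAdjoin in
/-- The derivations of `ℂ` over `ℚ` take arbitrary values on an algebraically independent
family. -/
theorem AlgebraicIndependent.exists_derivation {σ : Type*} {p : σ → ℂ}
    (hp : AlgebraicIndependent ℚ p) (v : σ → ℂ) :
    ∃ D : Derivation ℚ ℂ ℂ, ∀ i, D (p i) = v i := by
  classical
  have hinj : Function.Injective p := hp.injective
  obtain ⟨s, hs, hsB⟩ := exists_isTranscendenceBasis_superset (R := ℚ) (s := Set.range p) hp.coe_range
  let K := IntermediateField.adjoin ℚ (Set.range ((↑) : s → ℂ))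
  let A := Algebra.adjoin ℚ (Set.range ((↑) : s → ℂ))
  let e : MvPolynomial s ℚ ≃ₐ[ℚ] A := hsB.1.aevalEquiv
  have : Algebra.IsAlgebraic K ℂ := hsB.isAlgebraic_field
  have : Algebra.FormallyEtale K ℂ := Algebra.FormallyEtale.of_isSeparable _ _
  have : Algebra.FormallyEtale A K := .of_isLocalization (nonZeroDivisors _)
  have : Algebra.FormallyEtale A ℂ := .comp _ K _
  let w : s → ℂ := fun x => if h : ∃ i, p i = x then v h.choose else 0
  let _ : Module (MvPolynomial s ℚ) ℂ := Module.compHom ℂ (e : MvPolynomial s ℚ →+* A)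
  have _ : IsScalarTower ℚ (MvPolynomial s ℚ) ℂ := by
    refine ⟨fun q f z => ?_⟩
    change (e (q • f)) • z = q • (e f • z)
    rw [map_smul, smul_assoc]
  let d : Derivation ℚ (MvPolynomial s ℚ) ℂ := MvPolynomial.mkDerivation ℚ w
  let d' : Derivation ℚ A ℂ := Derivation.mk' (d.toLinearMap ∘ₗ e.symm.toLinearMap) (by
    intro a b
    change d (e.symm (a * b)) = a • d (e.symm b) + b • d (e.symm a)
    rw [map_mul, d.leibniz]
    change e (e.symm a) • (d (e.symm b) : ℂ) + e (e.symm b) • (d (e.symm a) : ℂ) = _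
    simp only [AlgEquiv.apply_symm_apply])
  let T := KaehlerDifferential.tensorKaehlerEquivOfFormallyEtale ℚ A ℂ
  let φ : TensorProduct A ℂ (Ω[A⁄ℚ]) →ₗ[ℂ] ℂ := LinearMap.liftBaseChange ℂ d'.liftKaehlerDifferential
  refine ⟨(φ ∘ₗ T.symm.toLinearMap).compDer (KaehlerDifferential.D ℚ ℂ), fun i => ?_⟩
  have hi : p i ∈ s := hs ⟨i, rfl⟩
  have hX : algebraMap A ℂ (e (MvPolynomial.X ⟨p i, hi⟩)) = p i := by
    exact (hsB.1.algebraMap_aevalEquiv _).trans (MvPolynomial.aeval_X _ _)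
  rw [← hX]
  change φ (T.symm (KaehlerDifferential.D ℚ ℂ _)) = _
  rw [KaehlerDifferential.tensorKaehlerEquivOfFormallyEtale_symm_D_algebraMap]
  simp only [φ, LinearMap.liftBaseChange_tmul, one_smul, Derivation.liftKaehlerDifferential_comp_D]
  change d (e.symm (e _)) = _
  rw [AlgEquiv.symm_apply_apply, MvPolynomial.mkDerivation_X]
  have h : ∃ j, p j = p i := ⟨i, rfl⟩
  simp only [w, dif_pos h]
  rw [hinj h.choose_spec]

theorem MvPolynomial.exists_eq_C_of_pderiv_eq_zero {σ : Type*} {f : MvPolynomial σ ℚ}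
    (h : ∀ i, pderiv i f = 0) : ∃ c, f = C c := by
  classical
  refine ⟨coeff 0 f, ?_⟩
  ext n
  rw [coeff_C]
  split_ifs with hn
  · rw [hn]
  · obtain ⟨i, hi⟩ : ∃ i, n i ≠ 0 := by
      by_contra! hc
      exact hn (by ext i; simp [hc i])
    have h1 := congrArg (coeff (n - Finsupp.single i 1)) (h i)
    rw [coeff_pderiv, coeff_zero] at h1
    have h2 : n - Finsupp.single i 1 + Finsupp.single i 1 = n :=
      tsub_add_cancel_of_le (by simpa [Nat.one_le_iff_ne_zero] using hi)
    rw [h2] at h1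
    refine (mul_eq_zero.1 h1).resolve_right ?_
    positivity

theorem MvPolynomial.totalDegree_pderiv_le {σ : Type*} (f : MvPolynomial σ ℚ) (i : σ) :
    (pderiv i f).totalDegree ≤ f.totalDegree - 1 := by
  classical
  refine Finset.sup_le fun n hn => ?_
  rw [mem_support_iff, coeff_pderiv] at hn
  have h1 := le_totalDegree (mem_support_iff.2 (left_ne_zero_of_mul hn))
  rw [Finsupp.sum_add_index' (fun _ => rfl) (fun _ _ _ => rfl),
    Finsupp.sum_single_index rfl] at h1
  omega

theorem Derivation.apply_aeval {τ : Type*} [Fintype τ] (w : τ → ℂ) (D : Derivation ℚ ℂ ℂ)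
    (f : MvPolynomial τ ℚ) :
    D (MvPolynomial.aeval w f) =
      ∑ i, MvPolynomial.aeval w (MvPolynomial.pderiv i f) * D (w i) := by
  classical
  induction f using MvPolynomial.induction_on with
  | C a =>
    have h : D (algebraMap ℚ ℂ a) = 0 := D.map_algebraMap a
    simpa using h
  | add f g hf hg => simp [hf, hg, add_mul, Finset.sum_add_distrib]
  | mul_X f j hf =>
    simp only [map_mul, MvPolynomial.aeval_X, Derivation.leibniz, hf, smul_eq_mul,
      MvPolynomial.pderiv_X, map_add, add_mul, Finset.sum_add_distrib, Finset.mul_sum]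
    congr 1
    · rw [Finset.sum_eq_single j]
      · simp
      · intro i _ hi
        simp [Ne.symm hi]
      · simp
    · exact Finset.sum_congr rfl fun i _ => by ring

/-- Jacobian criterion: a finite family of complex numbers whose derivatives satisfy no linear
relation is algebraically independent. -/
theorem algebraicIndependent_of_derivation {τ : Type*} [Fintype τ] {w : τ → ℂ}
    (Δ : Set (Derivation ℚ ℂ ℂ))
    (h : ∀ c : τ → ℂ, (∀ D ∈ Δ, ∑ i, c i * D (w i) = 0) → c = 0) :
    AlgebraicIndependent ℚ w := by
  rw [algebraicIndependent_iff]
  suffices H : ∀ n (f : MvPolynomial τ ℚ), f.totalDegree ≤ n → MvPolynomial.aeval w f = 0 → f = 0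
    from fun f hf => H _ f le_rfl hf
  have key : ∀ f : MvPolynomial τ ℚ, MvPolynomial.aeval w f = 0 →
      ∀ i, MvPolynomial.aeval w (MvPolynomial.pderiv i f) = 0 := by
    intro f hf
    refine congrFun (h _ fun D _ => ?_)
    rw [← D.apply_aeval, hf, map_zero]
  have hC : ∀ c : ℚ, MvPolynomial.aeval w (MvPolynomial.C c : MvPolynomial τ ℚ) = 0 →
      (MvPolynomial.C c : MvPolynomial τ ℚ) = 0 := by
    intro c hc
    simpa using hc
  intro n
  induction n with
  | zero =>
    intro f hf h0
    rw [MvPolynomial.totalDegree_eq_zero_iff_eq_C.1 (Nat.le_zero.1 hf)] at h0 ⊢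
    exact hC _ h0
  | succ n ih =>
    intro f hf h0
    obtain ⟨c, rfl⟩ := MvPolynomial.exists_eq_C_of_pderiv_eq_zero fun i =>
      ih _ ((f.totalDegree_pderiv_le i).trans (by omega)) (key f h0 i)
    exact hC _ h0

/-- A nonempty open subset of affine space contains a point with algebraically independent
coordinates. -/
theorem IsOpen.exists_algebraicIndependent {σ : Type*} [Finite σ] {U : Set (σ → ℂ)}
    (hU : IsOpen U) (hne : U.Nonempty) : ∃ p ∈ U, AlgebraicIndependent ℚ p := by
  have := Fintype.ofFinite σ
  have hdense : Dense (⋂ f : {f : MvPolynomial σ ℚ // f ≠ 0},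
      {p : σ → ℂ | MvPolynomial.aeval p f.1 ≠ 0}) := by
    have hcont (f : MvPolynomial σ ℚ) : Continuous fun p : σ → ℂ => MvPolynomial.aeval p f := by
      simp_rw [MvPolynomial.aeval_def, MvPolynomial.eval₂_eq_eval_map]
      exact MvPolynomial.continuous_eval _
    have : Countable {f : MvPolynomial σ ℚ // f ≠ 0} := by
      have : Countable (MvPolynomial σ ℚ) :=
        (AddMonoidAlgebra.coeffEquiv (R := ℚ) (M := σ →₀ ℕ)).injective.countable
      infer_instance
    refine dense_iInter_of_isOpen (fun f => isOpen_ne_fun (hcont _) continuous_const) fun f => ?_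
    rw [dense_iff_inter_open]
    rintro V hV ⟨q, hq⟩
    by_contra hcon
    obtain ⟨δ, hδ, hball⟩ := Metric.isOpen_iff.1 hV q hq
    refine f.2 (MvPolynomial.map_injective (algebraMap ℚ ℂ) (algebraMap ℚ ℂ).injective ?_)
    rw [map_zero]
    refine MvPolynomial.funext_set (fun i => Metric.ball (q i) δ) (fun i => ?_) fun x hx => ?_
    · exact infinite_of_mem_nhds (q i) (Metric.ball_mem_nhds _ hδ)
    · by_contra hx0
      refine hcon ⟨x, hball ?_, ?_⟩
      · rw [ball_pi q hδ]
        exact hx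
      · rw [Set.mem_ofPred_eq, MvPolynomial.aeval_def, MvPolynomial.eval₂_eq_eval_map]
        simpa using hx0
  obtain ⟨p, hpU, hp⟩ := hdense.inter_open_nonempty U hU hne
  refine ⟨p, hpU, algebraicIndependent_iff.2 fun f hf => ?_⟩
  by_contra h0
  exact Set.mem_iInter.1 hp ⟨f, h0⟩ hf

/-- The linear relations between the differentials of a family modulo the differentials of
another family. -/
def derivationRelations {ι κ : Type*} [Fintype ι] (p : ι → ℂ) (e : κ → ℂ) :
    Submodule ℂ (ι → ℂ) where
  carrier := {f | ∀ D : Derivation ℚ ℂ ℂ, (∀ k, D (e k) = 0) → ∑ i, f i * D (p i) = 0}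
  zero_mem' := by simp
  add_mem' := by
    intro f g hf hg D hD
    simp [add_mul, Finset.sum_add_distrib, hf D hD, hg D hD]
  smul_mem' := by
    intro c f hf D hD
    simp [mul_assoc, ← Finset.mul_sum, hf D hD]

theorem AlgebraicIndependent.finrank_derivationRelations_le {ι κ : Type*} [Fintype ι] [Fintype κ]
    {p : ι → ℂ} (hp : AlgebraicIndependent ℚ p) (e : κ → ℂ) :
    Module.finrank ℂ (derivationRelations p e) ≤ Fintype.card κ := by
  classical
  let ev (z : ℂ) : Derivation ℚ ℂ ℂ →ₗ[ℂ] ℂ :=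
    { toFun := fun D => D z
      map_add' := fun _ _ => rfl
      map_smul' := fun _ _ => rfl }
  let F : (ι → ℂ) →ₗ[ℂ] (Derivation ℚ ℂ ℂ →ₗ[ℂ] ℂ) :=
    Fintype.linearCombination ℂ fun i => ev (p i)
  have hF (f : ι → ℂ) (D : Derivation ℚ ℂ ℂ) : F f D = ∑ i, f i * D (p i) := by
    simp [F, Fintype.linearCombination_apply, ev]
  have hinj : Function.Injective F := by
    rw [← LinearMap.ker_eq_bot, LinearMap.ker_eq_bot']
    intro f hf
    ext i
    obtain ⟨D, hD⟩ := hp.exists_derivation (Pi.single i 1)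
    have := hF f D
    rw [hf] at this
    simpa [hD, Pi.single_apply] using this.symm
  have hmap : (derivationRelations p e).map F ≤
      Submodule.span ℂ (Set.range fun k => ev (e k)) := by
    rintro _ ⟨f, hf, rfl⟩
    refine mem_span_of_iInf_ker_le_ker fun D hD => ?_
    rw [Submodule.mem_iInf] at hD
    rw [LinearMap.mem_ker, hF]
    exact hf D hD
  calc Module.finrank ℂ (derivationRelations p e)
      = Module.finrank ℂ ((derivationRelations p e).map F) :=
        (LinearEquiv.finrank_eq (Submodule.equivMapOfInjective F hinj _))
    _ ≤ Module.finrank ℂ (Submodule.span ℂ (Set.range fun k => ev (e k))) := by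
        have : FiniteDimensional ℂ (Submodule.span ℂ (Set.range fun k => ev (e k))) :=
          FiniteDimensional.span_of_finite ℂ (Set.finite_range _)
        exact Submodule.finrank_mono hmap
    _ ≤ Fintype.card κ := finrank_range_le_card _

/-- Finitely many small spaces of polynomial vectors avoid the multiples of a common monic
polynomial. -/
theorem exists_monic_natDegree_eq_forall_dvd_imp {β σ : Type*} [Finite β] (K : ℕ)
    (M : β → Submodule ℂ (σ → Polynomial ℂ)) [∀ b, FiniteDimensional ℂ (M b)]
    (hM : ∀ b, Module.finrank ℂ (M b) ≤ K) :
    ∃ g : Polynomial ℚ, g.Monic ∧ g.natDegree = K ∧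
      ∀ b, ∀ f ∈ M b, (∀ s, g.map (algebraMap ℚ ℂ) ∣ f s) → f = 0 := by
  classical
  have := Fintype.ofFinite β
  induction K generalizing M with
  | zero =>
    refine ⟨1, Polynomial.monic_one, Polynomial.natDegree_one, fun b f hf _ => ?_⟩
    rw [Submodule.finrank_eq_zero.1 (Nat.le_zero.1 (hM b))] at hf
    simpa using hf
  | succ K ih =>
    have hch : ∀ b, ∃ q : Polynomial ℂ, q ≠ 0 ∧ (M b ≠ ⊥ → ∃ f ∈ M b, ∃ s, f s = q) := by
      intro b
      by_cases hb : M b = ⊥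
      · exact ⟨1, one_ne_zero, fun h => absurd hb h⟩
      · obtain ⟨f, hf, hf0⟩ := Submodule.exists_mem_ne_zero_of_ne_bot hb
        obtain ⟨s, hs⟩ := Function.ne_iff.1 hf0
        exact ⟨f s, hs, fun _ => ⟨f, hf, s, rfl⟩⟩
    choose q hq0 hq using hch
    have hprod : ∏ b, q b ≠ 0 := Finset.prod_ne_zero_iff.2 fun b _ => hq0 b
    obtain ⟨t, ht⟩ : ∃ t : ℕ, (∏ b, q b).eval (t : ℂ) ≠ 0 := by
      by_contra! hcon
      refine hprod (Polynomial.eq_zero_of_infinite_isRoot _ ?_)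
      exact (Set.infinite_range_of_injective (Nat.cast_injective (R := ℂ))).mono
        (by rintro _ ⟨n, rfl⟩; exact hcon n)
    let φ : (σ → Polynomial ℂ) →ₗ[ℂ] (σ → Polynomial ℂ) :=
      LinearMap.pi fun s => LinearMap.mulLeft ℂ (Polynomial.X - Polynomial.C (t : ℂ)) ∘ₗ
        LinearMap.proj s
    have hφ (f s) : φ f s = (Polynomial.X - Polynomial.C (t : ℂ)) * f s := rfl
    have hφi : Function.Injective φ := by
      intro f g h
      ext1 s
      have := congrFun h s
      rw [hφ, hφ] at this
      exact mul_left_cancel₀ (Polynomial.X_sub_C_ne_zero _) this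
    let e (b : β) : (M b).comap φ ≃ₗ[ℂ] ((M b).comap φ).map φ :=
      Submodule.equivMapOfInjective φ hφi _
    have hle (b : β) : ((M b).comap φ).map φ ≤ M b := Submodule.map_comap_le _ _
    have hfin (b : β) : FiniteDimensional ℂ (((M b).comap φ).map φ) :=
      Submodule.finiteDimensional_of_le (hle b)
    have hfin' (b : β) : FiniteDimensional ℂ ((M b).comap φ) :=
      LinearEquiv.finiteDimensional (e b).symm
    obtain ⟨g, hg, hgd, hgM⟩ := ih (fun b => (M b).comap φ) (fun b => by
      rw [(e b).finrank_eq]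
      by_cases hb : M b = ⊥
      · have := Submodule.finrank_mono (hle b)
        rw [hb, finrank_bot, ← hb] at this
        omega
      · obtain ⟨f, hf, s, hs⟩ := hq b hb
        have hlt : ((M b).comap φ).map φ < M b := by
          refine lt_of_le_of_ne (hle b) fun h => ?_
          rw [← h] at hf
          obtain ⟨u, -, rfl⟩ := hf
          rw [Polynomial.eval_prod] at ht
          refine Finset.prod_ne_zero_iff.1 ht b (Finset.mem_univ b) ?_
          rw [← hs, hφ]
          simp
        have := Submodule.finrank_lt_finrank_of_lt hlt
        have := hM b
        omega)
    refine ⟨(Polynomial.X - Polynomial.C (t : ℚ)) * g, (Polynomial.monic_X_sub_C _).mul hg, ?_,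
      fun b f hf hdvd => ?_⟩
    · rw [(Polynomial.monic_X_sub_C _).natDegree_mul hg, Polynomial.natDegree_X_sub_C, hgd, add_comm]
    · choose u hu using hdvd
      have hfu : f = φ fun s => g.map (algebraMap ℚ ℂ) * u s := by
        ext1 s
        rw [hu s, hφ]
        simp [mul_assoc]
      have := hgM b (fun s => g.map (algebraMap ℚ ℂ) * u s)
        (by rw [Submodule.mem_comap, ← hfu]; exact hf) (fun s => dvd_mul_right _ _)
      rw [hfu, this, map_zero]

/-- The leading components of the elements of `N` whose last nonzero component is at most `j`. -/
def leadingSubmodule {r : ℕ} {E : Type*} [AddCommGroup E] [Module ℂ E]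
    (N : Submodule ℂ (Fin r → E)) (j : Fin r) : Submodule ℂ E :=
  (N ⊓ ⨅ i > j, LinearMap.ker (LinearMap.proj i)).map (LinearMap.proj j)

theorem mem_leadingSubmodule {r : ℕ} {E : Type*} [AddCommGroup E] [Module ℂ E]
    {N : Submodule ℂ (Fin r → E)} {j : Fin r} {e : E} :
    e ∈ leadingSubmodule N j ↔ ∃ f ∈ N, (∀ i > j, f i = 0) ∧ f j = e := by
  simp [leadingSubmodule, Submodule.mem_map, Submodule.mem_iInf, and_assoc]

theorem sum_finrank_leadingSubmodule_le {r : ℕ} {E : Type*} [AddCommGroup E] [Module ℂ E]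
    [FiniteDimensional ℂ E] (N : Submodule ℂ (Fin r → E)) :
    ∑ j, Module.finrank ℂ (leadingSubmodule N j) ≤ Module.finrank ℂ N := by
  classical
  have hsec : ∀ j, ∃ sec : leadingSubmodule N j →ₗ[ℂ] (Fin r → E),
      ∀ e, sec e ∈ N ∧ (∀ i > j, sec e i = 0) ∧ sec e j = e := by
    intro j
    let P : Submodule ℂ (Fin r → E) := N ⊓ ⨅ i > j, LinearMap.ker (LinearMap.proj i)
    let π : P →ₗ[ℂ] leadingSubmodule N j := (LinearMap.proj j).submoduleMap P
    obtain ⟨sec, hs⟩ := π.exists_rightInverse_of_surjective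
      (LinearMap.range_eq_top.2 (LinearMap.submoduleMap_surjective _ _))
    refine ⟨P.subtype ∘ₗ sec, fun e => ⟨(sec e).2.1, fun i hi => ?_, ?_⟩⟩
    · have : (sec e).1 ∈ ⨅ i > j, LinearMap.ker (LinearMap.proj i) := (sec e).2.2
      simp only [Submodule.mem_iInf] at this
      exact this i hi
    · exact congrArg Subtype.val (LinearMap.congr_fun hs e)
  choose sec hsec using hsec
  let F : (∀ j, leadingSubmodule N j) →ₗ[ℂ] (Fin r → E) :=
    ∑ j, sec j ∘ₗ LinearMap.proj j
  have hF (e) : F e = ∑ j, sec j (e j) := by simp [F]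
  have hFN (e) : F e ∈ N := by
    rw [hF]
    exact N.sum_mem fun j _ => (hsec j _).1
  have hinj : Function.Injective (F.codRestrict N hFN) := by
    rw [← LinearMap.ker_eq_bot, LinearMap.ker_codRestrict, LinearMap.ker_eq_bot']
    intro e he
    by_contra h0
    obtain ⟨j₀, hj₀⟩ := Function.ne_iff.1 h0
    obtain ⟨j, hj, hmax⟩ := (Finset.univ.filter fun j => e j ≠ 0).exists_max_image id
      ⟨j₀, by simpa using hj₀⟩
    have h1 := congrFun he j
    rw [hF, Finset.sum_apply, Finset.sum_eq_single j, (hsec j _).2.2] at h1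
    · exact (Finset.mem_filter.1 hj).2 (Subtype.ext h1)
    · intro i _ hij
      rcases lt_or_gt_of_ne hij with h | h
      · exact (hsec i _).2.1 j h
      · have : e i = 0 := by
          by_contra hi
          exact absurd (hmax i (by simpa using hi)) (not_le.2 h)
        rw [this]
        simp
    · simp
  have := LinearMap.finrank_le_finrank_of_injective hinj
  rwa [Module.finrank_pi_fintype] at this

theorem eq_zero_of_mem_of_forall_leadingSubmodule {r : ℕ} {E : Type*} [AddCommGroup E]
    [Module ℂ E] {N : Submodule ℂ (Fin r → E)} {f : Fin r → E} (hf : f ∈ N)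
    (h : ∀ j, f j ∈ leadingSubmodule N j → f j = 0) : f = 0 := by
  classical
  by_contra h0
  obtain ⟨j₀, hj₀⟩ := Function.ne_iff.1 h0
  obtain ⟨j, hj, hmax⟩ := (Finset.univ.filter fun j => f j ≠ 0).exists_max_image id
    ⟨j₀, by simpa using hj₀⟩
  refine (Finset.mem_filter.1 hj).2 (h j (mem_leadingSubmodule.2 ⟨f, hf, fun i hi => ?_, rfl⟩))
  by_contra hi0
  exact absurd (hmax i (by simpa using hi0)) (not_le.2 hi)

/-- The matrix of multiplication by `g` from polynomials of degree less than `n` to polynomials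
of degree less than `m`, acting on rows. -/
noncomputable def polyMulMatrix (n m : ℕ) (g : Polynomial ℚ) : Matrix (Fin n) (Fin m) ℂ :=
  Matrix.of fun i l => algebraMap ℚ ℂ ((g * Polynomial.X ^ (i : ℕ)).coeff l)

theorem sum_polyMulMatrix {n m : ℕ} {g : Polynomial ℚ} (hg : g.natDegree + n ≤ m)
    (c : Fin n → ℂ) :
    ∑ l : Fin m, Polynomial.C (∑ i, c i * polyMulMatrix n m g i l) * Polynomial.X ^ (l : ℕ) =
      g.map (algebraMap ℚ ℂ) * ∑ i, Polynomial.C (c i) * Polynomial.X ^ (i : ℕ) := by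
  have h (i : Fin n) : ∑ l : Fin m, Polynomial.C (polyMulMatrix n m g i l) *
      Polynomial.X ^ (l : ℕ) = g.map (algebraMap ℚ ℂ) * Polynomial.X ^ (i : ℕ) := by
    have hlt : (g.map (algebraMap ℚ ℂ) * Polynomial.X ^ (i : ℕ)).natDegree < m := by
      refine lt_of_le_of_lt (Polynomial.natDegree_mul_le.trans
        (Nat.add_le_add (Polynomial.natDegree_map_le) (Polynomial.natDegree_X_pow_le _))) ?_
      have := i.2
      omega
    rw [Polynomial.as_sum_range_C_mul_X_pow' _ hlt, Finset.sum_range]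
    refine Finset.sum_congr rfl fun l _ => ?_
    rw [polyMulMatrix, Matrix.of_apply, ← Polynomial.coeff_map, Polynomial.map_mul, Polynomial.map_pow,
      Polynomial.map_X]
  simp only [map_sum, Finset.sum_mul, Finset.mul_sum]
  rw [Finset.sum_comm]
  refine Finset.sum_congr rfl fun i _ => ?_
  rw [mul_left_comm, ← h i, Finset.mul_sum]
  simp [mul_assoc]

theorem sum_C_mul_X_pow_eq_zero {n : ℕ} {c : Fin n → ℂ}
    (h : ∑ i, Polynomial.C (c i) * Polynomial.X ^ (i : ℕ) = 0) : c = 0 := by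
  ext i
  have := congrArg (fun q => Polynomial.coeff q (i : ℕ)) h
  simpa [Polynomial.finsetSum_coeff, Polynomial.coeff_X_pow, Fin.val_inj] using this

theorem polyMulMatrix_surjective {n m : ℕ} {g : Polynomial ℚ} (hg : g.natDegree + n ≤ m)
    (hg0 : g ≠ 0) : Function.Surjective (polyMulMatrix n m g).mulVec := by
  have hli : LinearIndependent ℂ (polyMulMatrix n m g).row := by
    rw [Fintype.linearIndependent_iff]
    intro c hc
    refine congrFun (sum_C_mul_X_pow_eq_zero ?_)
    have h1 := sum_polyMulMatrix hg c
    have h2 (l : Fin m) : ∑ i, c i * polyMulMatrix n m g i l = 0 := by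
      simpa using congrFun hc l
    simp only [h2, map_zero, zero_mul, Finset.sum_const_zero] at h1
    exact (mul_eq_zero.1 h1.symm).resolve_left
      ((Polynomial.map_ne_zero_iff (algebraMap ℚ ℂ).injective).2 hg0)
  have h1 := hli.rank_matrix
  have h2 : LinearMap.range (polyMulMatrix n m g).mulVecLin = ⊤ := by
    apply Submodule.eq_top_of_finrank_eq
    rw [← Matrix.rank, h1]
    simp
  exact LinearMap.range_eq_top.1 h2

/-- The graph of the transpose of a tuple of matrices. -/
def transposeGraph {m : ℕ} (Θ : Fin 3 → Matrix (Fin m) (Fin m) ℂ) :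
    (Fin 3 × Fin m → ℂ) →ₗ[ℂ] ((Fin 3 × Fin m) ⊕ (Fin 3 × Fin m) → ℂ) where
  toFun h := Sum.elim h fun t => ∑ l, h (t.1, l) * Θ t.1 l t.2
  map_add' f g := by
    ext (t | t) <;> simp [add_mul, Finset.sum_add_distrib]
  map_smul' c f := by
    ext (t | t) <;> simp [mul_assoc, Finset.mul_sum]

theorem transposeGraph_injective {m : ℕ} (Θ : Fin 3 → Matrix (Fin m) (Fin m) ℂ) :
    Function.Injective (transposeGraph Θ) := fun f g h => by
  ext t
  exact congrFun h (Sum.inl t)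

/-- The polynomials with the given coefficients. -/
noncomputable def polyOfCoeffs (m : ℕ) :
    (Fin 3 × Fin m → ℂ) →ₗ[ℂ] (Fin 3 → Polynomial ℂ) where
  toFun h s := ∑ l : Fin m, Polynomial.C (h (s, l)) * Polynomial.X ^ (l : ℕ)
  map_add' f g := by
    ext1 s
    simp [add_mul, Finset.sum_add_distrib]
  map_smul' c f := by
    ext1 s
    simp [Finset.smul_sum, Polynomial.smul_eq_C_mul, mul_assoc]

/-- The relations, modulo the differentials of `e`, between the differentials of the
coordinates of `x` and `ξ`, grouped by the first index. -/
def groupedRelations {r m : ℕ} {κ : Type*} (x ξ : Fin r → Fin 3 → Fin m → ℂ) (e : κ → ℂ) :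
    Submodule ℂ (Fin r → (Fin 3 × Fin m) ⊕ (Fin 3 × Fin m) → ℂ) where
  carrier := {f | ∀ D : Derivation ℚ ℂ ℂ, (∀ k, D (e k) = 0) →
    ∑ j, ∑ s, ∑ l, (f j (Sum.inl (s, l)) * D (x j s l) + f j (Sum.inr (s, l)) * D (ξ j s l)) = 0}
  zero_mem' := by simp
  add_mem' := by
    intro f g hf hg D hD
    rw [← add_zero (0 : ℂ)]
    nth_rewrite 1 [← hf D hD]
    rw [← hg D hD]
    simp only [← Finset.sum_add_distrib, Pi.add_apply]
    refine Finset.sum_congr rfl fun j _ => Finset.sum_congr rfl fun s _ =>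
      Finset.sum_congr rfl fun l _ => by ring
  smul_mem' := by
    intro c f hf D hD
    rw [← mul_zero c, ← hf D hD]
    simp [Finset.mul_sum, mul_add, mul_assoc]

theorem finrank_groupedRelations_le {r m : ℕ} {κ : Type*} [Fintype κ]
    {x ξ : Fin r → Fin 3 → Fin m → ℂ}
    (hp : AlgebraicIndependent ℚ (Sum.elim (fun i : Fin r × Fin 3 × Fin m => x i.1 i.2.1 i.2.2)
      (fun i : Fin r × Fin 3 × Fin m => ξ i.1 i.2.1 i.2.2))) (e : κ → ℂ) :
    Module.finrank ℂ (groupedRelations x ξ e) ≤ Fintype.card κ := by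
  refine le_trans ?_ (hp.finrank_derivationRelations_le e)
  let Φ : (Fin r → (Fin 3 × Fin m) ⊕ (Fin 3 × Fin m) → ℂ) →ₗ[ℂ]
      ((Fin r × Fin 3 × Fin m) ⊕ (Fin r × Fin 3 × Fin m) → ℂ) :=
    { toFun := fun f => Sum.elim (fun i => f i.1 (Sum.inl i.2)) (fun i => f i.1 (Sum.inr i.2))
      map_add' := by intro f g; ext (t | t) <;> simp
      map_smul' := by intro f g; ext (t | t) <;> simp }
  have hΦ : Function.Injective Φ := by
    intro f g h
    ext j (t | t)
    · exact congrFun h (Sum.inl (j, t))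
    · exact congrFun h (Sum.inr (j, t))
  have hmem : ∀ f ∈ groupedRelations x ξ e, Φ f ∈ derivationRelations
      (Sum.elim (fun i : Fin r × Fin 3 × Fin m => x i.1 i.2.1 i.2.2)
        (fun i : Fin r × Fin 3 × Fin m => ξ i.1 i.2.1 i.2.2)) e := by
    intro f hf D hD
    rw [← hf D hD]
    simp [Φ, Fintype.sum_sum_type, Fintype.sum_prod_type, Finset.sum_add_distrib]
  refine LinearMap.finrank_le_finrank_of_injective (f := Φ.restrict hmem) fun f g h => ?_
  exact Subtype.ext (hΦ (congrArg Subtype.val h))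

theorem Derivation.apply_mulVec_add {n m : ℕ} (D : Derivation ℚ ℂ ℂ)
    (A : Matrix (Fin n) (Fin m) ℂ) (hA : ∀ i l, D (A i l) = 0)
    (Θ : Matrix (Fin m) (Fin m) ℂ) (hΘ : ∀ i l, D (Θ i l) = 0) (x ξ : Fin m → ℂ) (i : Fin n) :
    D ((A.mulVec (x + Θ.mulVec ξ)) i) =
      ∑ l, A i l * (D (x l) + ∑ k, Θ l k * D (ξ k)) := by
  simp [Matrix.mulVec, dotProduct, Derivation.leibniz, hA, hΘ]

theorem algebraicIndependent_mulVec {r m n : ℕ} {κ : Type*}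
    {x ξ : Fin r → Fin 3 → Fin m → ℂ} {e : κ → ℂ} {g : Polynomial ℚ}
    (hg : g.natDegree + n ≤ m) (hg0 : g ≠ 0) (Θ : Fin 3 → Matrix (Fin m) (Fin m) ℂ)
    (hΘ : ∀ D : Derivation ℚ ℂ ℂ, (∀ k, D (e k) = 0) → ∀ s i l, D (Θ s i l) = 0)
    (J : Finset (Fin r))
    (hJ : ∀ j ∈ J, ∀ h, transposeGraph Θ h ∈ leadingSubmodule (groupedRelations x ξ e) j →
      (∀ s, g.map (algebraMap ℚ ℂ) ∣ polyOfCoeffs m h s) → polyOfCoeffs m h = 0) :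
    AlgebraicIndependent ℚ fun i : J × Fin 3 × Fin n =>
      ((polyMulMatrix n m g).mulVec (x i.1 i.2.1 + (Θ i.2.1).mulVec (ξ i.1 i.2.1))) i.2.2 := by
  classical
  refine algebraicIndependent_of_derivation {D | ∀ k, D (e k) = 0} fun c hc => ?_
  let c' (j : Fin r) (s : Fin 3) (i : Fin n) : ℂ := if hj : j ∈ J then c (⟨j, hj⟩, s, i) else 0
  let h (j : Fin r) (t : Fin 3 × Fin m) : ℂ := ∑ i, c' j t.1 i * polyMulMatrix n m g i t.2
  have hpoly (j s) : polyOfCoeffs m (h j) s =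
      g.map (algebraMap ℚ ℂ) * ∑ i, Polynomial.C (c' j s i) * Polynomial.X ^ (i : ℕ) :=
    sum_polyMulMatrix hg (c' j s)
  have hc' (j) (hj : polyOfCoeffs m (h j) = 0) (s) : c' j s = 0 := by
    refine sum_C_mul_X_pow_eq_zero ?_
    have := hpoly j s
    rw [hj] at this
    exact (mul_eq_zero.1 this.symm).resolve_left
      ((Polynomial.map_ne_zero_iff (algebraMap ℚ ℂ).injective).2 hg0)
  have hmem : (fun j => transposeGraph Θ (h j)) ∈ groupedRelations x ξ e := by
    intro D hD
    rw [← hc D hD, Fintype.sum_prod_type]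
    have hA : ∀ i l, D (polyMulMatrix n m g i l) = 0 := fun i l => D.map_algebraMap _
    let F (j : Fin r) : ℂ := ∑ t : Fin 3 × Fin n, c' j t.1 t.2 *
      D (((polyMulMatrix n m g).mulVec (x j t.1 + (Θ t.1).mulVec (ξ j t.1))) t.2)
    have h1 : ∑ j, F j = ∑ j : J, F j := by
      rw [Finset.sum_coe_sort J F]
      refine (Finset.sum_subset (Finset.subset_univ J) fun j _ hj => ?_).symm
      simp [F, c', hj]
    trans ∑ j, F j
    · refine Finset.sum_congr rfl fun j _ => ?_
      simp only [F, Fintype.sum_prod_type]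
      refine Finset.sum_congr rfl fun s _ => ?_
      simp only [D.apply_mulVec_add _ hA (Θ s) (hΘ D hD s), transposeGraph, LinearMap.coe_mk,
        AddHom.coe_mk, Sum.elim_inl, Sum.elim_inr, Finset.sum_add_distrib, mul_add,
        Finset.mul_sum, Finset.sum_mul, h]
      congr 1
      · rw [Finset.sum_comm]
        simp only [mul_assoc]
      · rw [Finset.sum_comm]
        simp_rw [fun l : Fin m => Finset.sum_comm (s := (Finset.univ : Finset (Fin m)))
          (t := (Finset.univ : Finset (Fin n)))
          (f := fun k i => c' j s i * polyMulMatrix n m g i l * Θ s l k * D (ξ j s k))]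
        rw [Finset.sum_comm]
        simp only [mul_assoc]
    · rw [h1]
      refine Finset.sum_congr rfl fun j _ => ?_
      simp [F, c']
  have hzero := eq_zero_of_mem_of_forall_leadingSubmodule hmem fun j hj => by
    by_cases hjJ : j ∈ J
    · have h0 := hc' j (hJ j hjJ (h j) hj fun s => by rw [hpoly]; exact dvd_mul_right _ _)
      have : h j = 0 := by
        ext t
        simp [h, h0]
      rw [this, map_zero]
    · have : h j = 0 := by
        ext t
        simp [h, c', hjJ]
      rw [this, map_zero]
  ext ⟨j, s, i⟩
  have h0 : h j = 0 := transposeGraph_injective Θ ((congrFun hzero j).trans (map_zero _).symm)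
  have := congrFun (hc' j (by rw [h0, map_zero]) s) i
  simpa [c'] using this

/-- Generic points and their translates by fixed matrices remain algebraically independent, after
removing a few indices and projecting. -/
theorem exists_projection_algebraicIndependent {r m K : ℕ} (hK : K ≤ m)
    {x ξ : Fin r → Fin 3 → Fin m → ℂ}
    (hp : AlgebraicIndependent ℚ (Sum.elim (fun i : Fin r × Fin 3 × Fin m => x i.1 i.2.1 i.2.2)
      (fun i : Fin r × Fin 3 × Fin m => ξ i.1 i.2.1 i.2.2)))
    (Ψ : Fin 3 → Matrix (Fin m) (Fin m) ℂ) :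
    ∃ J : Finset (Fin r), r * (K + 1) ≤ J.card * (K + 1) + 3 * m ^ 2 ∧
      ∃ A : Matrix (Fin (m - K)) (Fin m) ℂ, Function.Surjective A.mulVec ∧
        AlgebraicIndependent ℚ (fun i : J × Fin 3 × Fin (m - K) =>
          (A.mulVec (x i.1 i.2.1)) i.2.2) ∧
        AlgebraicIndependent ℚ (fun i : J × Fin 3 × Fin (m - K) =>
          (A.mulVec (x i.1 i.2.1 + (Ψ i.2.1).mulVec (ξ i.1 i.2.1))) i.2.2) := by
  classical
  let e (k : Fin 3 × Fin m × Fin m) : ℂ := Ψ k.1 k.2.1 k.2.2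
  let N := groupedRelations x ξ e
  let J : Finset (Fin r) :=
    Finset.univ.filter fun j => Module.finrank ℂ (leadingSubmodule N j) ≤ K
  have hN : Module.finrank ℂ N ≤ 3 * m ^ 2 := by
    refine (finrank_groupedRelations_le hp e).trans (le_of_eq ?_)
    simp [sq]
  have hcard : Jᶜ.card * (K + 1) ≤ 3 * m ^ 2 := by
    refine le_trans ?_ ((sum_finrank_leadingSubmodule_le N).trans hN)
    rw [← smul_eq_mul]
    refine (Finset.card_nsmul_le_sum Jᶜ _ _ fun j hj => ?_).trans
      (Finset.sum_le_sum_of_subset (Finset.subset_univ _))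
    simp only [J, Finset.mem_compl, Finset.mem_filter, Finset.mem_univ, true_and, not_le] at hj
    omega
  refine ⟨J, ?_, ?_⟩
  · have := Finset.card_add_card_compl J
    rw [Fintype.card_fin] at this
    calc r * (K + 1) = J.card * (K + 1) + Jᶜ.card * (K + 1) := by rw [← add_mul, this]
      _ ≤ _ := by omega
  let Θ (b : Bool) : Fin 3 → Matrix (Fin m) (Fin m) ℂ := if b then Ψ else 0
  let M (b : J × Bool) : Submodule ℂ (Fin 3 → Polynomial ℂ) :=
    ((leadingSubmodule N b.1).comap (transposeGraph (Θ b.2))).map (polyOfCoeffs m)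
  obtain ⟨g, hg, hgd, hgM⟩ := exists_monic_natDegree_eq_forall_dvd_imp K M fun b => by
    refine (Submodule.finrank_map_le _ _).trans (le_trans ?_ (Finset.mem_filter.1 b.1.2).2)
    refine LinearMap.finrank_le_finrank_of_injective
      (f := (transposeGraph (Θ b.2)).restrict
        (p := (leadingSubmodule N b.1).comap (transposeGraph (Θ b.2)))
        (q := leadingSubmodule N b.1) fun f hf => hf) fun f g h => ?_
    exact Subtype.ext (transposeGraph_injective _ (congrArg Subtype.val h))
  have hgK : g.natDegree + (m - K) ≤ m := by omega
  have hmain (b : Bool) := algebraicIndependent_mulVec (x := x) (ξ := ξ) (e := e) hgK hg.ne_zero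
    (Θ b) (fun D hD s i l => by
      cases b
      · simp [Θ]
      · exact hD (s, i, l)) J
    (fun j hj h hmem hdvd => hgM (⟨j, hj⟩, b) _ ⟨h, hmem, rfl⟩ hdvd)
  refine ⟨polyMulMatrix (m - K) m g, polyMulMatrix_surjective hgK hg.ne_zero, ?_, hmain true⟩
  simpa [Θ] using hmain false

/-- The pure tensor with the given factors. -/
def pureTensor {ι R : Type*} [CommSemiring R] (v : Fin 3 → ι → R) (i : Fin 3 → ι) : R :=
  ∏ s, v s (i s)

theorem pureTensor_update {ι R : Type*} [CommSemiring R] (v : Fin 3 → ι → R) (s : Fin 3)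
    (w : ι → R) (i : Fin 3 → ι) :
    pureTensor (Function.update v s w) i = w (i s) * ∏ t ∈ Finset.univ.erase s, v t (i t) := by
  rw [pureTensor, ← Finset.mul_prod_erase _ _ (Finset.mem_univ s), Function.update_self]
  congr 1
  refine Finset.prod_congr rfl fun t ht => ?_
  rw [Function.update_of_ne (Finset.ne_of_mem_erase ht)]

/-- A function on a three-element set is a triple. -/
def tripleEquiv (α : Type*) : (Fin 3 → α) ≃ α × α × α where
  toFun f := (f 0, f 1, f 2)
  invFun p := ![p.1, p.2.1, p.2.2]
  left_inv f := by
    ext i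
    fin_cases i <;> rfl
  right_inv p := rfl

theorem sum_fin_three_fun {α M : Type*} [Fintype α] [AddCommMonoid M] (f : (Fin 3 → α) → M) :
    ∑ i, f i = ∑ a, ∑ b, ∑ c, f ![a, b, c] := by
  rw [← (tripleEquiv α).symm.sum_comp, Fintype.sum_prod_type]
  simp_rw [Fintype.sum_prod_type]
  rfl

/-- The matrix of equations imposed on a `3 × 3 × 3` tensor by contracting it with two vectors
of a triple of vectors. -/
def blockMatrix {R : Type*} [CommSemiring R] (u : Fin 3 → Fin 3 → Fin 3 → Fin 3 → R) :
    Matrix (Fin 3 → Fin 3) (Fin 3 → Fin 3) R :=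
  Matrix.of fun i' i =>
    pureTensor (Function.update (u (i' 0) (i' 1)) (i' 0) (Pi.single (i' 2) 1)) i

/-- A triple of triples of vectors for which the block matrix is invertible. -/
def baseConfig : Fin 3 → Fin 3 → Fin 3 → Fin 3 → ℚ :=
  ![![![0, ![1, 0, 0], ![1, 0, 0]], ![0, ![0, 1, 0], ![0, 1, 0]], ![0, ![0, 0, 1], ![0, 0, 1]]],
    ![![![1, 0, 0], 0, ![0, 1, 1]], ![![0, 1, 0], 0, ![1, 0, 1]], ![![0, 0, 1], 0, ![1, 1, 0]]],
    ![![![1, -1, 0], ![-1, 0, 1], 0], ![![0, 1, 1], ![-1, 1, 0], 0],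
      ![![-1, 0, 1], ![0, 1, 1], 0]]]

theorem det_blockMatrix_baseConfig : (blockMatrix baseConfig).det ≠ 0 := by
  intro hdet
  obtain ⟨T, hT0, hT⟩ := Matrix.exists_mulVec_eq_zero_iff.2 hdet
  have key (s a v : Fin 3) : ∑ i, pureTensor (Function.update (baseConfig s a) s
      (Pi.single v 1)) i * T i = 0 := by
    have := congrFun hT ![s, a, v]
    exact this
  simp only [sum_fin_three_fun, pureTensor_update] at key
  have e0 : (Finset.univ.erase 0 : Finset (Fin 3)) = {1, 2} := by decide
  have e1 : (Finset.univ.erase 1 : Finset (Fin 3)) = {0, 2} := by decide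
  have e2 : (Finset.univ.erase 2 : Finset (Fin 3)) = {0, 1} := by decide
  have k0 (a v : Fin 3) := key 0 a v
  have k1 (a v : Fin 3) := key 1 a v
  have k2 (a v : Fin 3) := key 2 a v
  simp only [e0, e1, e2, Fin.sum_univ_three, baseConfig, Finset.prod_pair (show (1 : Fin 3) ≠ 2 by decide),
    Finset.prod_pair (show (0 : Fin 3) ≠ 2 by decide),
    Finset.prod_pair (show (0 : Fin 3) ≠ 1 by decide)] at k0 k1 k2
  have h0 (v a : Fin 3) : T ![v, a, a] = 0 := by
    have := k0 a v
    fin_cases a <;> fin_cases v <;> simpa using this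
  refine hT0 ?_
  have k10 := fun v => k1 0 v
  have k11 := fun v => k1 1 v
  have k12 := fun v => k1 2 v
  have k20 := fun v => k2 0 v
  have k21 := fun v => k2 1 v
  have k22 := fun v => k2 2 v
  have a0 := k10 0
  have a1 := k10 1
  have a2 := k10 2
  have b0 := k11 0
  have b1 := k11 1
  have b2 := k11 2
  have c0 := k12 0
  have c1 := k12 1
  have c2 := k12 2
  have d0 := k20 0
  have d1 := k20 1
  have d2 := k20 2
  have f0 := k21 0
  have f1 := k21 1
  have f2 := k21 2
  have g0 := k22 0
  have g1 := k22 1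
  have g2 := k22 2
  clear k10 k11 k12 k20 k21 k22 k0 k1 k2 key hT hdet
  simp [h0] at a0 a1 a2 b0 b1 b2 c0 c1 c2 d0 d1 d2 f0 f1 f2 g0 g1 g2
  have hT : ∀ a b c, T ![a, b, c] = 0 := by
    intro a b c
    fin_cases a <;> fin_cases b <;> fin_cases c <;> first | exact h0 _ _ | (simp; linarith)
  ext i
  rw [← (tripleEquiv (Fin 3)).symm_apply_apply i]
  exact hT _ _ _

theorem AlgebraicIndependent.det_ne_zero {σ τ K : Type*} [Fintype τ] [DecidableEq τ] [Field K]
    [Algebra ℚ K] {w : σ → ℂ} (hw : AlgebraicIndependent ℚ w)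
    (P : Matrix τ τ (MvPolynomial σ ℚ)) (x : σ → K)
    (hx : (P.map (MvPolynomial.aeval x)).det ≠ 0) : (P.map (MvPolynomial.aeval w)).det ≠ 0 := by
  have h1 : (P.map (MvPolynomial.aeval x)).det = MvPolynomial.aeval x P.det :=
    (AlgHom.map_det (MvPolynomial.aeval x) P).symm
  have h2 : (P.map (MvPolynomial.aeval w)).det = MvPolynomial.aeval w P.det :=
    (AlgHom.map_det (MvPolynomial.aeval w) P).symm
  rw [h1] at hx
  rw [h2]
  intro h
  rw [(algebraicIndependent_iff.1 hw) _ h, map_zero] at hx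
  exact hx rfl

theorem map_pureTensor {ι R S F : Type*} [CommSemiring R] [CommSemiring S] [FunLike F R S]
    [RingHomClass F R S] (f : F) (v : Fin 3 → ι → R) (i : Fin 3 → ι) :
    f (pureTensor v i) = pureTensor (fun s j => f (v s j)) i :=
  map_prod f _ _

theorem map_pureTensor_update {ι R S F : Type*} [DecidableEq ι] [CommSemiring R] [CommSemiring S]
    [FunLike F R S] [RingHomClass F R S] (f : F) (v : Fin 3 → ι → R) (s : Fin 3) (a : ι)
    (i : Fin 3 → ι) :
    f (pureTensor (Function.update v s (Pi.single a 1)) i) =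
      pureTensor (Function.update (fun s j => f (v s j)) s (Pi.single a 1)) i := by
  rw [pureTensor_update, pureTensor_update, map_mul, map_prod]
  congr 1
  rw [Pi.single_apply, Pi.single_apply]
  split_ifs <;> simp

theorem eq_zero_of_blockMatrix_mulVec {u : Fin 3 → Fin 3 → Fin 3 → Fin 3 → ℂ}
    (hu : AlgebraicIndependent ℚ fun k : Fin 3 × Fin 3 × Fin 3 × Fin 3 =>
      u k.1 k.2.1 k.2.2.1 k.2.2.2) {T : (Fin 3 → Fin 3) → ℂ}
    (hT : (blockMatrix u).mulVec T = 0) : T = 0 := by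
  let P : Matrix (Fin 3 → Fin 3) (Fin 3 → Fin 3) (MvPolynomial (Fin 3 × Fin 3 × Fin 3 × Fin 3) ℚ) :=
    blockMatrix fun s a t i => MvPolynomial.X (s, a, t, i)
  have hP {K : Type} [Field K] [Algebra ℚ K] (x : Fin 3 → Fin 3 → Fin 3 → Fin 3 → K) :
      P.map (MvPolynomial.aeval fun k : Fin 3 × Fin 3 × Fin 3 × Fin 3 =>
        x k.1 k.2.1 k.2.2.1 k.2.2.2) = blockMatrix x := by
    ext i' i
    simp only [P, blockMatrix, Matrix.map_apply, Matrix.of_apply]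
    rw [map_pureTensor_update]
    simp
  have hdet := hu.det_ne_zero P (fun k : Fin 3 × Fin 3 × Fin 3 × Fin 3 =>
        baseConfig k.1 k.2.1 k.2.2.1 k.2.2.2) (by
    rw [hP baseConfig]
    exact det_blockMatrix_baseConfig)
  rw [hP u] at hdet
  by_contra h0
  exact hdet (Matrix.exists_mulVec_eq_zero_iff.1 ⟨T, h0, hT⟩)

section Cells

variable (G : Type*) [AddCommGroup G]

/-- The triples summing to zero. -/
abbrev Cell := {g : Fin 3 → G // ∑ s, g s = 0}

/-- The triples that do not sum to zero. -/
abbrev OffCell := {g : Fin 3 → G // ¬ ∑ s, g s = 0}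

variable {G}

/-- The triple summing to zero obtained by modifying one entry. -/
def OffCell.cell (h : OffCell G) (s : Fin 3) : Cell G :=
  ⟨Function.update h.1 s (h.1 s - ∑ t, h.1 t), by
    rw [Finset.sum_update_of_mem (Finset.mem_univ s), ← Finset.sum_sdiff
      (Finset.subset_univ {s}) (f := h.1), Finset.sum_singleton]
    abel⟩

theorem OffCell.cell_injective (h : OffCell G) : Function.Injective h.cell := by
  intro s t hst
  by_contra hne
  have := congrFun (congrArg Subtype.val hst) s
  simp only [OffCell.cell, Function.update_self, Function.update_of_ne hne] at this
  exact h.2 (by simpa using this)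

theorem card_cell [Fintype G] [DecidableEq G] :
    Fintype.card (Cell G) = Fintype.card G ^ 2 := by
  rw [sq, ← Fintype.card_prod]
  refine Fintype.card_congr
    { toFun := fun h => (h.1 0, h.1 1)
      invFun := fun p => ⟨![p.1, p.2, -(p.1 + p.2)], by simp [Fin.sum_univ_three]⟩
      left_inv := fun h => ?_
      right_inv := fun p => rfl }
  ext i
  have := h.2
  rw [Fin.sum_univ_three] at this
  fin_cases i
  · rfl
  · rfl
  · exact neg_eq_of_add_eq_zero_right this

theorem card_offCell [Fintype G] [DecidableEq G] :
    Fintype.card (OffCell G) + Fintype.card G ^ 2 = Fintype.card G ^ 3 := by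
  have h1 := card_cell (G := G)
  have h2 : Fintype.card (OffCell G) = _ :=
    Fintype.card_subtype_compl (fun g : Fin 3 → G => ∑ s, g s = 0)
  have h3 := Fintype.card_subtype_le (fun g : Fin 3 → G => ∑ s, g s = 0)
  rw [h1, Fintype.card_fun, Fintype.card_fin] at h2 h3
  rw [h2]
  omega

variable [Fintype G] [DecidableEq G]

/-- The coefficients, in the blocks outside the cells, of the tangent vectors at the points
indexed by the cells. -/
def offMatrix {R : Type*} [CommSemiring R] (X : Cell G × Fin 3 → Fin 3 → G × Fin 3 → R) :
    Matrix (OffCell G × (Fin 3 → Fin 3)) (OffCell G × (Fin 3 → Fin 3)) R :=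
  Matrix.of fun h' h => pureTensor (Function.update (X (h'.1.cell (h'.2 0), h'.2 1)) (h'.2 0)
    (Pi.single (h'.1.1 (h'.2 0), h'.2 2) 1)) fun t => (h.1.1 t, h.2 t)

theorem det_offMatrix_ne_zero {X : Cell G × Fin 3 → Fin 3 → G × Fin 3 → ℂ}
    (hX : AlgebraicIndependent ℚ fun k : (Cell G × Fin 3) × Fin 3 × G × Fin 3 =>
      X k.1 k.2.1 k.2.2) : (offMatrix X).det ≠ 0 := by
  let P : Matrix (OffCell G × (Fin 3 → Fin 3)) (OffCell G × (Fin 3 → Fin 3))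
      (MvPolynomial ((Cell G × Fin 3) × Fin 3 × G × Fin 3) ℚ) :=
    offMatrix fun j t i => MvPolynomial.X (j, t, i)
  have hP (x : Cell G × Fin 3 → Fin 3 → G × Fin 3 → ℂ) :
      P.map (MvPolynomial.aeval fun k : (Cell G × Fin 3) × Fin 3 × G × Fin 3 =>
        x k.1 k.2.1 k.2.2) = offMatrix x := by
    ext i' i
    simp only [P, offMatrix, Matrix.map_apply, Matrix.of_apply]
    rw [map_pureTensor_update]
    simp
  let c (j : Cell G × Fin 3) (t : Fin 3) (i : G × Fin 3) : ℂ :=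
    if i.1 = j.1.1 t then X j t i else 0
  rw [← hP X]
  refine hX.det_ne_zero P (fun k : (Cell G × Fin 3) × Fin 3 × G × Fin 3 => c k.1 k.2.1 k.2.2) ?_
  rw [hP c]
  intro hdet
  obtain ⟨T, hT0, hT⟩ := Matrix.exists_mulVec_eq_zero_iff.2 hdet
  refine hT0 ?_
  ext ⟨h, i⟩
  let u (s a t i : Fin 3) : ℂ := X (h.cell s, a) t (h.1 t, i)
  have hu : AlgebraicIndependent ℚ fun k : Fin 3 × Fin 3 × Fin 3 × Fin 3 =>
      u k.1 k.2.1 k.2.2.1 k.2.2.2 := by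
    refine hX.comp (fun k : Fin 3 × Fin 3 × Fin 3 × Fin 3 =>
      ((h.cell k.1, k.2.1), k.2.2.1, (h.1 k.2.2.1, k.2.2.2))) ?_
    rintro ⟨s, a, t, i⟩ ⟨s', a', t', i'⟩ he
    simp only [Prod.mk.injEq] at he
    obtain ⟨⟨h1, h2⟩, h3, h4, h5⟩ := he
    rw [h.cell_injective h1, h2, h3, h5]
  refine congrFun (eq_zero_of_blockMatrix_mulVec (T := fun i => T (h, i)) hu ?_) i
  ext i'
  have hrow := congrFun hT (h, i')
  rw [Matrix.mulVec, dotProduct, Fintype.sum_prod_type, Finset.sum_eq_single h] at hrow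
  · refine Eq.trans ?_ hrow
    rw [Matrix.mulVec, dotProduct]
    refine Finset.sum_congr rfl fun i _ => ?_
    congr 1
    simp only [blockMatrix, offMatrix, Matrix.of_apply, pureTensor_update]
    congr 1
    · simp [Pi.single_apply]
    · refine Finset.prod_congr rfl fun t ht => ?_
      simp [u, c, OffCell.cell, Function.update_of_ne (Finset.ne_of_mem_erase ht)]
  · intro h2 _ hne
    refine Finset.sum_eq_zero fun i _ => ?_
    rw [offMatrix, Matrix.of_apply, pureTensor_update]
    obtain ⟨t, ht⟩ := Function.ne_iff.1 (fun hh => hne (Subtype.ext hh))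
    by_cases hts : t = i' 0
    · subst hts
      simp [ht]
    · rw [Finset.prod_eq_zero (Finset.mem_erase.2 ⟨hts, Finset.mem_univ t⟩)]
      · simp
      · simp [c, OffCell.cell, Function.update_of_ne hts, ht]
  · simp

end Cells

/-- The linear parametrization of the sum of the tangent spaces to the variety of pure tensors at
the points `X j`. -/
def pureTangent {ι J : Type*} [Fintype J] (X : J → Fin 3 → ι → ℂ) :
    (J → Fin 3 → ι → ℂ) →ₗ[ℂ] ((Fin 3 → ι) → ℂ) where
  toFun c i := ∑ j, ∑ s, c j s (i s) * ∏ t ∈ Finset.univ.erase s, X j t (i t)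
  map_add' c d := by
    ext i
    simp [add_mul, Finset.sum_add_distrib]
  map_smul' a c := by
    ext i
    simp [Finset.mul_sum, mul_assoc]

theorem pureTangent_eq {ι J : Type*} [Fintype J] (X : J → Fin 3 → ι → ℂ)
    (c : J → Fin 3 → ι → ℂ) :
    pureTangent X c = ∑ j, ∑ s, pureTensor (Function.update (X j) s (c j s)) := by
  ext i
  simp [pureTangent, pureTensor_update]

theorem pureTangent_single {ι J : Type*} [Fintype J] [DecidableEq J] (X : J → Fin 3 → ι → ℂ)
    (j : J) (s : Fin 3) (w : ι → ℂ) :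
    pureTangent X (Pi.single j (Pi.single s w)) = pureTensor (Function.update (X j) s w) := by
  ext i
  rw [pureTensor_update, pureTangent, LinearMap.coe_mk, AddHom.coe_mk, Finset.sum_eq_single j,
    Finset.sum_eq_single s]
  · simp
  · intro t _ ht
    simp [ht]
  · simp
  · intro k _ hk
    simp [hk]
  · simp

theorem Submodule.eq_top_of_forall_sum_mul_eq_zero {τ : Type*} [Fintype τ]
    (W : Submodule ℂ (τ → ℂ)) (h : ∀ T : τ → ℂ, (∀ w ∈ W, ∑ i, w i * T i = 0) → T = 0) :
    W = ⊤ := by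
  classical
  by_contra hW
  obtain ⟨f, hf0, hf⟩ := W.exists_dual_map_eq_bot_of_lt_top (lt_top_iff_ne_top.2 hW) inferInstance
  have hfw (w : τ → ℂ) : f w = ∑ i, w i * f (Pi.single i 1) := by
    conv_lhs => rw [LinearMap.pi_apply_eq_sum_univ f w]
    refine Finset.sum_congr rfl fun i _ => ?_
    rw [smul_eq_mul]
    congr 2
    ext j
    simp [Pi.single_apply, eq_comm]
  refine hf0 (LinearMap.ext fun w => ?_)
  have := h (fun i => f (Pi.single i 1)) fun w hw => by
    rw [← hfw]
    have : f w ∈ W.map f := ⟨w, hw, rfl⟩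
    rw [hf] at this
    simpa using this
  rw [hfw]
  simp [funext_iff] at this
  simp [this]

/-- Tangent spaces at generic points fill almost everything when there are enough of them. -/
theorem le_finrank_range_pureTangent {G : Type*} [AddCommGroup G] [Fintype G] [DecidableEq G]
    {X : Cell G × Fin 3 → Fin 3 → G × Fin 3 → ℂ}
    (hX : AlgebraicIndependent ℚ fun k : (Cell G × Fin 3) × Fin 3 × G × Fin 3 =>
      X k.1 k.2.1 k.2.2) :
    27 * Fintype.card G ^ 3 ≤ Module.finrank ℂ (LinearMap.range (pureTangent X)) +
      27 * Fintype.card G ^ 2 := by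
  let π : ((Fin 3 → G × Fin 3) → ℂ) →ₗ[ℂ] (OffCell G × (Fin 3 → Fin 3) → ℂ) :=
    LinearMap.funLeft ℂ ℂ fun h t => (h.1.1 t, h.2 t)
  have htop : (LinearMap.range (pureTangent X)).map π = ⊤ := by
    refine Submodule.eq_top_of_forall_sum_mul_eq_zero _ fun T hT => ?_
    by_contra h0
    refine det_offMatrix_ne_zero hX (Matrix.exists_mulVec_eq_zero_iff.1 ⟨T, h0, ?_⟩)
    ext ⟨h, i⟩
    refine hT _ ⟨pureTensor (Function.update (X (h.cell (i 0), i 1)) (i 0)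
      (Pi.single (h.1 (i 0), i 2) 1)), ⟨_, pureTangent_single X _ _ _⟩, ?_⟩
    ext k
    rfl
  have h1 := Submodule.finrank_map_le π (LinearMap.range (pureTangent X))
  rw [htop, finrank_top, Module.finrank_fintype_fun_eq_card, Fintype.card_prod, Fintype.card_fun,
    Fintype.card_fin] at h1
  have h2 := card_offCell (G := G)
  omega

section Mask

variable {κ : Type*} [DecidableEq κ]

/-- Restriction of a function to a finite set, extended by zero. -/
def mask (S : Finset κ) : (κ → ℂ) →ₗ[ℂ] (κ → ℂ) where
  toFun f i := if i ∈ S then f i else 0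
  map_add' f g := by
    ext i
    by_cases h : i ∈ S <;> simp [h]
  map_smul' c f := by
    ext i
    by_cases h : i ∈ S <;> simp [h]

theorem mask_apply (S : Finset κ) (f : κ → ℂ) (i : κ) :
    mask S f i = if i ∈ S then f i else 0 := rfl

theorem mask_eq_mask {S : Finset κ} {f g : κ → ℂ} (h : ∀ i ∈ S, f i = g i) :
    mask S f = mask S g := by
  ext i
  by_cases hi : i ∈ S <;> simp [mask_apply, hi, h]

theorem mask_eq_zero {S : Finset κ} {f : κ → ℂ} (h : ∀ i ∈ S, f i = 0) : mask S f = 0 := by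
  rw [← map_zero (mask S)]
  exact mask_eq_mask h

variable [Fintype κ]

theorem finrank_le_card_of_support {A : Finset κ} {V : Submodule ℂ (κ → ℂ)}
    (h : ∀ f ∈ V, ∀ i ∉ A, f i = 0) : Module.finrank ℂ V ≤ A.card := by
  let φ : V →ₗ[ℂ] (A → ℂ) := LinearMap.funLeft ℂ ℂ (Subtype.val : A → κ) ∘ₗ V.subtype
  have hφ : Function.Injective φ := by
    intro f g hfg
    ext i
    by_cases hi : i ∈ A
    · exact congrFun hfg ⟨i, hi⟩
    · rw [h f f.2 i hi, h g g.2 i hi]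
  have := LinearMap.finrank_le_finrank_of_injective hφ
  simpa using this

theorem finrank_map_add_finrank_inf_ker {V V' : Type*} [AddCommGroup V] [Module ℂ V]
    [AddCommGroup V'] [Module ℂ V'] [FiniteDimensional ℂ V] (W : Submodule ℂ V)
    (f : V →ₗ[ℂ] V') :
    Module.finrank ℂ (W.map f) + Module.finrank ℂ ↥(W ⊓ LinearMap.ker f) =
      Module.finrank ℂ W := by
  have h1 := (f.domRestrict W).finrank_range_add_finrank_ker
  rw [LinearMap.range_domRestrict, LinearMap.ker_domRestrict] at h1
  have h2 := (Submodule.equivMapOfInjective W.subtype W.injective_subtype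
    ((LinearMap.ker f).comap W.subtype)).finrank_eq
  rw [Submodule.map_comap_subtype] at h2
  rw [← h1, h2.symm]

theorem finrank_map_add_le {V V' : Type*} [AddCommGroup V] [Module ℂ V]
    [AddCommGroup V'] [Module ℂ V'] [FiniteDimensional ℂ V] {W W₁ : Submodule ℂ V}
    (f : V →ₗ[ℂ] V') (h : W₁ ≤ W) (h' : W₁ ≤ LinearMap.ker f) :
    Module.finrank ℂ (W.map f) + Module.finrank ℂ W₁ ≤ Module.finrank ℂ W := by
  rw [← finrank_map_add_finrank_inf_ker W f]
  exact Nat.add_le_add_left (Submodule.finrank_mono (le_inf h h')) _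

theorem card_le_finrank_map_mask {W : Submodule ℂ (κ → ℂ)} {d : ℕ}
    (hW : Fintype.card κ ≤ Module.finrank ℂ W + d) (S : Finset κ) :
    S.card ≤ Module.finrank ℂ (W.map (mask S)) + d := by
  have h1 := finrank_map_add_finrank_inf_ker W (mask S)
  have h2 : Module.finrank ℂ ↥(W ⊓ LinearMap.ker (mask S)) ≤ Sᶜ.card := by
    refine finrank_le_card_of_support fun f hf i hi => ?_
    have := congrFun (LinearMap.mem_ker.1 hf.2) i
    rw [mask_apply, if_pos (by simpa using hi)] at this
    exact this
  have h3 := Finset.card_add_card_compl S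
  omega

end Mask

section Pairs

variable {ι J : Type*} [Fintype J]

theorem erase_eq_pair {s t u : Fin 3} (hst : s ≠ t) (hsu : s ≠ u) (htu : t ≠ u) :
    (Finset.univ.erase s : Finset (Fin 3)) = {t, u} := by
  revert s t u
  decide

theorem eq_or_eq_or_eq {s t u : Fin 3} (hst : s ≠ t) (hsu : s ≠ u) (htu : t ≠ u) (x : Fin 3) :
    x = s ∨ x = t ∨ x = u := by
  revert s t u x
  decide

theorem pureTensor_update_eq {R : Type*} [CommSemiring R] {s t u : Fin 3} (hst : s ≠ t)
    (hsu : s ≠ u) (htu : t ≠ u) (v : Fin 3 → ι → R) (w : ι → R) (i : Fin 3 → ι) :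
    pureTensor (Function.update v s w) i = w (i s) * (v t (i t) * v u (i u)) := by
  rw [pureTensor_update, erase_eq_pair hst hsu htu, Finset.prod_pair htu]

/-- Coordinates of a triple in a prescribed order. -/
def orderedEquiv {s t u : Fin 3} (hst : s ≠ t) (hsu : s ≠ u) (htu : t ≠ u) (ι : Type*) :
    (Fin 3 → ι) ≃ ι × ι × ι where
  toFun i := (i s, i t, i u)
  invFun p x := if x = s then p.1 else if x = t then p.2.1 else p.2.2
  left_inv i := by
    ext x
    have := eq_or_eq_or_eq hst hsu htu x
    rcases this with rfl | rfl | rfl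
    · simp
    · simp [hst.symm]
    · simp [hsu.symm, htu.symm]
  right_inv p := by simp [hst.symm, hsu.symm, htu.symm]

theorem sum_pureTensor_apply {s t u : Fin 3} (hst : s ≠ t)
    (hsu : s ≠ u) (htu : t ≠ u) (X : J → Fin 3 → ι → ℂ) (c : J → ι → ℂ) (i : Fin 3 → ι) :
    (∑ j, pureTensor (Function.update (X j) s (c j))) i =
      ∑ j, c j (i s) * (X j t (i t) * X j u (i u)) := by
  rw [Finset.sum_apply]
  exact Finset.sum_congr rfl fun j _ => pureTensor_update_eq hst hsu htu _ _ _

variable [Fintype ι] [DecidableEq ι]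

/-- The span of the products of two factors, restricted to the complement of `B` in the
second coordinate. -/
noncomputable def pairMap (X : J → Fin 3 → ι → ℂ) (t u : Fin 3) (B : Finset ι) :
    (J → ℂ) →ₗ[ℂ] (ι × ι → ℂ) :=
  mask (Finset.univ ×ˢ Bᶜ) ∘ₗ
    Fintype.linearCombination ℂ fun j b => X j t b.1 * X j u b.2

theorem pairMap_apply (X : J → Fin 3 → ι → ℂ) (t u : Fin 3) (B : Finset ι) (l : J → ℂ)
    (b : ι × ι) :
    pairMap X t u B l b = if b.2 ∈ B then 0 else ∑ j, l j * (X j t b.1 * X j u b.2) := by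
  simp [pairMap, mask_apply, Fintype.linearCombination_apply]

theorem le_finrank_range_pairMap {s t u : Fin 3} (hst : s ≠ t) (hsu : s ≠ u) (htu : t ≠ u)
    {X : J → Fin 3 → ι → ℂ} {d : ℕ}
    (hX : Fintype.card ι ^ 3 ≤ Module.finrank ℂ (LinearMap.range (pureTangent X)) + d)
    (B : Finset ι) :
    Fintype.card ι ^ 2 * Bᶜ.card ≤
      Fintype.card ι * Module.finrank ℂ (LinearMap.range (pairMap X t u B)) +
        2 * Fintype.card ι * Fintype.card J + d := by
  let A : Finset (Fin 3 → ι) := Finset.univ.filter fun i => i u ∉ B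
  have hA : A.card = Fintype.card ι ^ 2 * Bᶜ.card := by
    have : A = ((Finset.univ : Finset ι) ×ˢ (Finset.univ : Finset ι) ×ˢ Bᶜ).map
        (orderedEquiv hst hsu htu ι).symm.toEmbedding := by
      ext i
      rw [Finset.mem_map_equiv]
      simp [A, orderedEquiv]
    rw [this, Finset.card_map, Finset.card_product, Finset.card_product, Finset.card_univ]
    ring
  have h1 := card_le_finrank_map_mask (W := LinearMap.range (pureTangent X)) (d := d)
    (by rw [Fintype.card_fun, Fintype.card_fin]; exact hX) A
  rw [hA] at h1
  let S := LinearMap.range (pairMap X t u B)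
  let φ₁ : (ι → S) →ₗ[ℂ] ((Fin 3 → ι) → ℂ) :=
    { toFun := fun f i => (f (i s)).1 (i t, i u)
      map_add' := fun _ _ => rfl
      map_smul' := fun _ _ => rfl }
  let σ (x : Fin 3) : (J → ι → ℂ) →ₗ[ℂ] (J → Fin 3 → ι → ℂ) :=
    LinearMap.pi fun j => LinearMap.single ℂ (fun _ => ι → ℂ) x ∘ₗ LinearMap.proj j
  let φ : ((ι → S) × (J → ι → ℂ) × (J → ι → ℂ)) →ₗ[ℂ] ((Fin 3 → ι) → ℂ) :=
    φ₁.coprod ((mask A ∘ₗ pureTangent X ∘ₗ σ t).coprod (mask A ∘ₗ pureTangent X ∘ₗ σ u))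
  have hle : (LinearMap.range (pureTangent X)).map (mask A) ≤ LinearMap.range φ := by
    rintro _ ⟨_, ⟨c, rfl⟩, rfl⟩
    refine ⟨(fun a => ⟨pairMap X t u B fun j => c j s a, _, rfl⟩, fun j => c j t,
      fun j => c j u), ?_⟩
    have hc : c = σ s (fun j => c j s) + σ t (fun j => c j t) + σ u (fun j => c j u) := by
      ext j x
      have := eq_or_eq_or_eq hst hsu htu x
      rcases this with rfl | rfl | rfl
      · simp [σ, hst, hsu]
      · simp [σ, hst.symm, htu]
      · simp [σ, hsu.symm, htu.symm]
    conv_rhs => rw [hc]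
    simp only [φ, LinearMap.coprod_apply, map_add, add_assoc, LinearMap.comp_apply]
    congr 1
    ext i
    have h2 : pureTangent X (σ s fun j => c j s) i =
        ∑ j, c j s (i s) * (X j t (i t) * X j u (i u)) := by
      rw [← sum_pureTensor_apply hst hsu htu X (fun j => c j s), pureTangent_eq]
      simp only [Finset.sum_apply]
      refine Finset.sum_congr rfl fun j _ => ?_
      rw [Finset.sum_eq_single s]
      · simp [σ]
      · intro x _ hx
        simp [σ, pureTensor_update, hx]
      · simp
    rw [mask_apply, h2]
    simp only [φ₁, LinearMap.coe_mk, AddHom.coe_mk, pairMap_apply, A, Finset.mem_filter,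
      Finset.mem_univ, true_and, ite_not]
  have h2 := (Submodule.finrank_mono hle).trans (LinearMap.finrank_range_le φ)
  simp only [Module.finrank_prod, Module.finrank_pi_fintype, Module.finrank_self, Finset.sum_const,
    Finset.card_univ, smul_eq_mul, mul_one] at h2
  have : Module.finrank ℂ S = Module.finrank ℂ (LinearMap.range (pairMap X t u B)) := rfl
  rw [← this]
  linarith

theorem exists_submodule_of_pair {s t u : Fin 3} (hst : s ≠ t) (hsu : s ≠ u) (htu : t ≠ u)
    {X : J → Fin 3 → ι → ℂ} {d : ℕ}
    (hX : Fintype.card ι ^ 3 ≤ Module.finrank ℂ (LinearMap.range (pureTangent X)) + d)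
    (I : Fin 3 → Finset ι) {R : Submodule ℂ ((Fin 3 → ι) → ℂ)}
    (hR : ∀ j v, (∀ i ∉ I s, v i = 0) → pureTensor (Function.update (X j) s v) ∈ R) :
    ∃ Y ≤ R, (∀ T ∈ Y, ∀ i, i s ∉ I s → T i = 0) ∧
      (∀ T ∈ Y, ∀ i, i t ∉ I t → i u ∉ I u → T i = 0) ∧
      (I s).card * (Fintype.card ι * ((I t).card * (I u)ᶜ.card)) ≤
        Fintype.card ι *
          Module.finrank ℂ (Y.map (mask (Finset.univ.filter fun i => i u ∉ I u))) +
        (I s).card * (2 * Fintype.card ι * Fintype.card J + d) := by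
  have h1 := le_finrank_range_pairMap hst hsu htu hX (I u)
  let S := LinearMap.range (pairMap X t u (I u))
  let mt : (ι × ι → ℂ) →ₗ[ℂ] (ι × ι → ℂ) := mask ((I t)ᶜ ×ˢ Finset.univ)
  let D : Submodule ℂ (ι × ι → ℂ) := S ⊓ LinearMap.ker mt
  have hS : ∀ f ∈ S, ∀ b : ι × ι, b.2 ∈ I u → f b = 0 := by
    rintro _ ⟨l, rfl⟩ b hb
    rw [pairMap_apply, if_pos hb]
  have h2 : Module.finrank ℂ (S.map mt) ≤ (I t)ᶜ.card * (I u)ᶜ.card := by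
    rw [← Finset.card_product]
    refine finrank_le_card_of_support ?_
    rintro _ ⟨f, hf, rfl⟩ b hb
    simp only [mt, mask_apply, Finset.mem_product, Finset.mem_compl, Finset.mem_univ, and_true]
    by_cases h : b.1 ∈ I t
    · simp [h]
    · rw [if_pos h]
      refine hS f hf b ?_
      by_contra h'
      exact hb (by simp [h, h'])
  have h3 : Module.finrank ℂ (S.map mt) + Module.finrank ℂ D = Module.finrank ℂ S :=
    finrank_map_add_finrank_inf_ker S mt
  obtain ⟨sec, hsec⟩ := (pairMap X t u (I u)).rangeRestrict.exists_rightInverse_of_surjective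
    (LinearMap.range_rangeRestrict _)
  have hsec' (f : S) : pairMap X t u (I u) (sec f) = f :=
    congrArg Subtype.val (LinearMap.congr_fun hsec f)
  let cf (g : I s → D) (j : J) (x : Fin 3) : ι → ℂ := if x = s then
    fun a => if ha : a ∈ I s then sec ⟨(g ⟨a, ha⟩).1, (g ⟨a, ha⟩).2.1⟩ j else 0 else 0
  let cfl : (I s → D) →ₗ[ℂ] (J → Fin 3 → ι → ℂ) :=
    { toFun := cf
      map_add' := by
        intro f g
        ext j x a
        by_cases hx : x = s <;> by_cases ha : a ∈ I s <;> simp [cf, hx, ha]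
        exact congrFun (sec.map_add ⟨(f ⟨a, ha⟩).1, (f ⟨a, ha⟩).2.1⟩
          ⟨(g ⟨a, ha⟩).1, (g ⟨a, ha⟩).2.1⟩) j
      map_smul' := by
        intro c f
        ext j x a
        by_cases hx : x = s <;> by_cases ha : a ∈ I s <;> simp [cf, hx, ha]
        exact congrFun (sec.map_smul c ⟨(f ⟨a, ha⟩).1, (f ⟨a, ha⟩).2.1⟩) j }
  have hcf (g) : pureTangent X (cfl g) = ∑ j, pureTensor (Function.update (X j) s (cf g j s)) := by
    rw [pureTangent_eq]
    refine Finset.sum_congr rfl fun j _ => ?_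
    rw [Finset.sum_eq_single s]
    · rfl
    · intro x _ hx
      ext i
      simp [cfl, cf, pureTensor_update, hx]
    · simp
  have hval (g : I s → D) (i : Fin 3 → ι) (hi : i u ∉ I u) : pureTangent X (cfl g) i =
      if h : i s ∈ I s then (g ⟨i s, h⟩).1 (i t, i u) else 0 := by
    rw [hcf, sum_pureTensor_apply hst hsu htu]
    split_ifs with h
    · have := congrFun (hsec' ⟨(g ⟨i s, h⟩).1, (g ⟨i s, h⟩).2.1⟩) (i t, i u)
      rw [pairMap_apply, if_neg hi] at this
      rw [← this]
      simp [cf, h]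
    · simp [cf, h]
  refine ⟨LinearMap.range (pureTangent X ∘ₗ cfl), ?_, ?_, ?_, ?_⟩
  · rintro _ ⟨g, rfl⟩
    rw [LinearMap.comp_apply, hcf]
    refine R.sum_mem fun j _ => hR j _ fun i hi => ?_
    simp [cf, hi]
  · rintro _ ⟨g, rfl⟩ i hi
    rw [LinearMap.comp_apply, hcf, sum_pureTensor_apply hst hsu htu]
    simp [cf, hi]
  · rintro _ ⟨g, rfl⟩ i hti hui
    rw [LinearMap.comp_apply, hval g i hui]
    split_ifs with h
    · have := congrFun (LinearMap.mem_ker.1 (g ⟨i s, h⟩).2.2) (i t, i u)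
      simpa [mt, mask_apply, hti] using this
    · rfl
  · rw [← LinearMap.range_comp]
    have hinj : Function.Injective (mask (Finset.univ.filter fun i : Fin 3 → ι => i u ∉ I u) ∘ₗ
        pureTangent X ∘ₗ cfl) := by
      intro f g hfg
      ext ⟨a, ha⟩ b
      by_cases hb : b.2 ∈ I u
      · rw [hS _ (f ⟨a, ha⟩).2.1 b hb, hS _ (g ⟨a, ha⟩).2.1 b hb]
      · have := congrFun hfg ((orderedEquiv hst hsu htu ι).symm (a, b.1, b.2))
        have e := (orderedEquiv hst hsu htu ι).apply_symm_apply (a, b.1, b.2)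
        generalize (orderedEquiv hst hsu htu ι).symm (a, b.1, b.2) = i at this e
        simp only [orderedEquiv, Equiv.coe_fn_mk, Prod.mk.injEq] at e
        obtain ⟨rfl, e1, e2⟩ := e
        have hi : i u ∉ I u := by rw [e2]; exact hb
        simp only [LinearMap.comp_apply, mask_apply, Finset.mem_filter, Finset.mem_univ, true_and,
          hval _ i hi, ha, dif_pos, e1, e2] at this
        rwa [if_pos hb, if_pos hb] at this
    rw [LinearMap.finrank_range_of_inj hinj, Module.finrank_pi_fintype]
    simp only [Finset.sum_const, Finset.card_univ, Fintype.card_coe, smul_eq_mul]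
    have hcard := Finset.card_add_card_compl (I t)
    have hSf : Module.finrank ℂ (LinearMap.range (pairMap X t u (I u))) =
      Module.finrank ℂ S := rfl
    rw [hSf] at h1
    have key : Fintype.card ι * ((I t).card * (I u)ᶜ.card) ≤
        Fintype.card ι * Module.finrank ℂ D + (2 * Fintype.card ι * Fintype.card J + d) := by
      have h4 : Fintype.card ι * Module.finrank ℂ S ≤
          Fintype.card ι * ((I t)ᶜ.card * (I u)ᶜ.card + Module.finrank ℂ D) :=
        Nat.mul_le_mul_left _ (by omega)
      have h5 : Fintype.card ι ^ 2 * (I u)ᶜ.card = Fintype.card ι * ((I t).card * (I u)ᶜ.card) +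
          Fintype.card ι * ((I t)ᶜ.card * (I u)ᶜ.card) := by
        conv_lhs => rw [sq, ← hcard]
        rw [← hcard]
        ring
      rw [h5] at h1
      linarith
    calc _ ≤ (I s).card * (Fintype.card ι * Module.finrank ℂ D +
          (2 * Fintype.card ι * Fintype.card J + d)) := Nat.mul_le_mul_left _ key
      _ = _ := by ring

end Pairs

section Bounds

variable {ι J : Type*} [Fintype ι] [DecidableEq ι] [Fintype J]

theorem finset_card_le_finrank_map_mask {Z : J → Fin 3 → ι → ℂ} {d : ℕ}
    (hZ : Fintype.card ι ^ 3 ≤ Module.finrank ℂ (LinearMap.range (pureTangent Z)) + d)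
    {R : Submodule ℂ ((Fin 3 → ι) → ℂ)} (S : Finset (Fin 3 → ι))
    (h : ∀ j s q, ∃ T ∈ R, ∀ i ∈ S, T i = pureTensor (Function.update (Z j) s q) i) :
    S.card ≤ Module.finrank ℂ (R.map (mask S)) + d := by
  refine (card_le_finrank_map_mask (W := LinearMap.range (pureTangent Z))
    (by rwa [Fintype.card_fun, Fintype.card_fin]) S).trans
    (Nat.add_le_add_right (Submodule.finrank_mono ?_) _)
  rintro _ ⟨_, ⟨c, rfl⟩, rfl⟩
  rw [pureTangent_eq, map_sum]
  refine Submodule.sum_mem _ fun j _ => ?_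
  rw [map_sum]
  refine Submodule.sum_mem _ fun s _ => ?_
  obtain ⟨T, hT, hT'⟩ := h j s (c j s)
  exact ⟨T, hT, mask_eq_mask hT'⟩

theorem card_piFinset_compl_add_le {X : J → Fin 3 → ι → ℂ} {d : ℕ}
    (hJ : 3 * Fintype.card J = Fintype.card ι ^ 2)
    (hX : Fintype.card ι ^ 3 ≤ Module.finrank ℂ (LinearMap.range (pureTangent X)) + d)
    (I : Fin 3 → Finset ι) {R : Submodule ℂ ((Fin 3 → ι) → ℂ)}
    (hP : ∀ j s v, (∀ i ∉ I s, v i = 0) → pureTensor (Function.update (X j) s v) ∈ R)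
    (hQ : ∀ j s q, ∃ T ∈ R, ∀ i : Fin 3 → ι, (∀ t, i t ∉ I t) →
      T i = pureTensor (Function.update (X j) s q) i) :
    ∏ s, (I s)ᶜ.card + Fintype.card J * ∑ s, (I s).card ≤ Module.finrank ℂ R + 2 * d := by
  let S : Finset (Fin 3 → ι) := Fintype.piFinset fun s => (I s)ᶜ
  have hS : ∀ i, i ∈ S ↔ ∀ t, i t ∉ I t := fun i => by simp [S]
  have h1 := finset_card_le_finrank_map_mask hX (R := R) S fun j s q => by
    obtain ⟨T, hT, hT'⟩ := hQ j s q
    exact ⟨T, hT, fun i hi => hT' i ((hS i).1 hi)⟩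
  let e : (J → (s : Fin 3) → I s → ℂ) →ₗ[ℂ] (J → Fin 3 → ι → ℂ) :=
    { toFun := fun c j s a => if h : a ∈ I s then c j s ⟨a, h⟩ else 0
      map_add' := by
        intro f g
        ext j s a
        by_cases h : a ∈ I s <;> simp [h]
      map_smul' := by
        intro c f
        ext j s a
        by_cases h : a ∈ I s <;> simp [h] }
  have he : Function.Injective e := by
    intro f g hfg
    ext j s ⟨a, ha⟩
    have := congrFun (congrFun (congrFun hfg j) s) a
    simpa [e, ha] using this
  have h2 := finrank_map_add_finrank_inf_ker (LinearMap.range e) (pureTangent X)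
  have h3 : Module.finrank ℂ (LinearMap.range e) = Fintype.card J * ∑ s, (I s).card := by
    rw [LinearMap.finrank_range_of_inj he]
    simp [Module.finrank_pi_fintype]
  have h4 := (pureTangent X).finrank_range_add_finrank_ker
  simp only [Module.finrank_pi_fintype, Module.finrank_self, Finset.sum_const,
    Finset.card_univ, smul_eq_mul, mul_one, Fintype.card_fin] at h4
  have h5 : Module.finrank ℂ ↥(LinearMap.range e ⊓ LinearMap.ker (pureTangent X)) ≤
      Module.finrank ℂ (LinearMap.ker (pureTangent X)) := Submodule.finrank_mono inf_le_right
  have h6 : Fintype.card J * (3 * Fintype.card ι) = Fintype.card ι ^ 3 := by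
    rw [pow_succ, ← hJ]
    ring
  have h7 := finrank_map_add_le (mask S) (W := R) (W₁ := (LinearMap.range e).map (pureTangent X))
    (by
      rintro _ ⟨_, ⟨c, rfl⟩, rfl⟩
      rw [pureTangent_eq]
      refine R.sum_mem fun j _ => R.sum_mem fun s _ => hP j s _ fun i hi => ?_
      simp [e, hi])
    (by
      rintro _ ⟨_, ⟨c, rfl⟩, rfl⟩
      refine LinearMap.mem_ker.2 (mask_eq_zero fun i hi => ?_)
      rw [pureTangent_eq]
      simp only [Finset.sum_apply, pureTensor_update]
      refine Finset.sum_eq_zero fun j _ => Finset.sum_eq_zero fun s _ => ?_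
      simp [e, (hS i).1 hi s])
  have h8 : S.card = ∏ s, (I s)ᶜ.card := Fintype.card_piFinset _
  omega

/-- The triples with at most one coordinate in the given sets. -/
def atMostOne (I : Fin 3 → Finset ι) : Finset (Fin 3 → ι) :=
  Finset.univ.filter fun i => ∀ s t, s ≠ t → i s ∈ I s → i t ∉ I t

theorem card_atMostOne {s t u : Fin 3} (hst : s ≠ t) (hsu : s ≠ u) (htu : t ≠ u)
    (I : Fin 3 → Finset ι) :
    (atMostOne I).card = (I s)ᶜ.card * ((I t)ᶜ.card * (I u)ᶜ.card) +
      (I s).card * ((I t)ᶜ.card * (I u)ᶜ.card) + (I s)ᶜ.card * ((I t).card * (I u)ᶜ.card) +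
      (I s)ᶜ.card * ((I t)ᶜ.card * (I u).card) := by
  have key (A B C : Finset ι) : A.card * (B.card * C.card) =
      ∑ i : Fin 3 → ι, if i s ∈ A ∧ i t ∈ B ∧ i u ∈ C then 1 else 0 := by
    rw [← Finset.card_product, ← Finset.card_product, ← Finset.card_filter,
      ← Finset.card_map (orderedEquiv hst hsu htu ι).symm.toEmbedding]
    congr 1
    ext i
    rw [Finset.mem_map_equiv]
    simp [orderedEquiv]
  rw [key, key, key, key, atMostOne, Finset.card_filter, ← Finset.sum_add_distrib,
    ← Finset.sum_add_distrib, ← Finset.sum_add_distrib]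
  refine Finset.sum_congr rfl fun i _ => ?_
  have : (∀ x y, x ≠ y → i x ∈ I x → i y ∉ I y) ↔
      ¬ (i s ∈ I s ∧ i t ∈ I t) ∧ ¬ (i s ∈ I s ∧ i u ∈ I u) ∧ ¬ (i t ∈ I t ∧ i u ∈ I u) := by
    constructor
    · intro h
      exact ⟨fun h' => h s t hst h'.1 h'.2, fun h' => h s u hsu h'.1 h'.2,
        fun h' => h t u htu h'.1 h'.2⟩
    · rintro ⟨h1, h2, h3⟩ x y hxy hx hy
      rcases eq_or_eq_or_eq hst hsu htu x with rfl | rfl | rfl <;>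
        rcases eq_or_eq_or_eq hst hsu htu y with rfl | rfl | rfl <;> tauto
  simp only [this, Finset.mem_compl]
  by_cases h1 : i s ∈ I s <;> by_cases h2 : i t ∈ I t <;> by_cases h3 : i u ∈ I u <;>
    simp [h1, h2, h3]

theorem card_atMostOne_add_le {s t u : Fin 3} (hst : s ≠ t) (hsu : s ≠ u) (htu : t ≠ u)
    {X X' : J → Fin 3 → ι → ℂ} {d : ℕ} (hn : 0 < Fintype.card ι)
    (hJ : 3 * Fintype.card J = Fintype.card ι ^ 2)
    (hX : Fintype.card ι ^ 3 ≤ Module.finrank ℂ (LinearMap.range (pureTangent X)) + d)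
    (hX' : Fintype.card ι ^ 3 ≤ Module.finrank ℂ (LinearMap.range (pureTangent X')) + d)
    (I : Fin 3 → Finset ι) {R : Submodule ℂ ((Fin 3 → ι) → ℂ)}
    (hP : ∀ j s v, (∀ i ∉ I s, v i = 0) → pureTensor (Function.update (X j) s v) ∈ R)
    (hQ : ∀ j s q, ∃ T ∈ R, ∀ i ∈ atMostOne I,
      T i = pureTensor (Function.update (X' j) s q) i) :
    ((atMostOne I).card : ℝ) +
      max 0 ((I s).card * (I t).card * (Fintype.card ι - (I u).card : ℝ) -
        2 / 3 * (Fintype.card ι : ℝ) ^ 2 * (I t).card) +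
      max 0 ((I s).card * (I u).card * (Fintype.card ι - (I t).card : ℝ) -
        2 / 3 * (Fintype.card ι : ℝ) ^ 2 * (I u).card) ≤ Module.finrank ℂ R + 2 * d := by
  have h1 := finset_card_le_finrank_map_mask hX' (R := R) (atMostOne I) hQ
  obtain ⟨Y₁, hY₁, hv₁, hw₁, hb₁⟩ :=
    exists_submodule_of_pair hst.symm htu hsu hX I (R := R) fun j v => hP j t v
  obtain ⟨Y₂, hY₂, hv₂, hw₂, hb₂⟩ :=
    exists_submodule_of_pair hsu.symm htu.symm hst hX I (R := R) fun j v => hP j u v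
  have hker : Y₁ ⊔ Y₂ ≤ LinearMap.ker (mask (atMostOne I)) := by
    refine sup_le (fun T hT => LinearMap.mem_ker.2 (mask_eq_zero fun i hi => ?_))
      (fun T hT => LinearMap.mem_ker.2 (mask_eq_zero fun i hi => ?_))
    · have hi' := (Finset.mem_filter.1 hi).2
      by_cases h : i t ∈ I t
      · exact hw₁ T hT i (hi' t s hst.symm h) (hi' t u htu h)
      · exact hv₁ T hT i h
    · have hi' := (Finset.mem_filter.1 hi).2
      by_cases h : i u ∈ I u
      · exact hw₂ T hT i (hi' u s hsu.symm h) (hi' u t htu.symm h)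
      · exact hv₂ T hT i h
  have h2 := finrank_map_add_le (mask (atMostOne I)) (sup_le hY₁ hY₂) hker
  let M : ((Fin 3 → ι) → ℂ) →ₗ[ℂ] _ := mask (Finset.univ.filter fun i : Fin 3 → ι => i u ∉ I u)
  have h3 := finrank_map_add_le M (W := Y₁ ⊔ Y₂) (W₁ := Y₂) le_sup_right
    (fun T hT => LinearMap.mem_ker.2
      (mask_eq_zero fun i hi => hv₂ T hT i (Finset.mem_filter.1 hi).2))
  have h4 : Module.finrank ℂ (Y₁.map M) ≤ Module.finrank ℂ ((Y₁ ⊔ Y₂).map M) :=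
    Submodule.finrank_mono (Submodule.map_mono le_sup_left)
  have h5 := Submodule.finrank_map_le
    (mask (Finset.univ.filter fun i : Fin 3 → ι => i t ∉ I t)) Y₂
  have hc (x : Fin 3) : ((I x)ᶜ.card : ℝ) = Fintype.card ι - (I x).card := by
    rw [Finset.card_compl, Nat.cast_sub (Finset.card_le_univ _)]
  have ha (x : Fin 3) : ((I x).card : ℝ) ≤ Fintype.card ι := by
    exact_mod_cast Finset.card_le_univ _
  have hb₁' : ((I t).card : ℝ) * (Fintype.card ι * ((I s).card * (Fintype.card ι - (I u).card))) ≤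
      Fintype.card ι * Module.finrank ℂ (Y₁.map M) +
        (I t).card * (2 * Fintype.card ι * Fintype.card J + d) := by
    rw [← hc]
    exact_mod_cast hb₁
  have hb₂' : ((I u).card : ℝ) * (Fintype.card ι * ((I s).card * (Fintype.card ι - (I t).card))) ≤
      Fintype.card ι * Module.finrank ℂ (Y₂.map
        (mask (Finset.univ.filter fun i : Fin 3 → ι => i t ∉ I t))) +
        (I u).card * (2 * Fintype.card ι * Fintype.card J + d) := by
    rw [← hc]
    exact_mod_cast hb₂
  have hfin : ((atMostOne I).card : ℝ) + Module.finrank ℂ (Y₁.map M) + Module.finrank ℂ (Y₂.map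
        (mask (Finset.univ.filter fun i : Fin 3 → ι => i t ∉ I t))) ≤ Module.finrank ℂ R + d := by
    have : (atMostOne I).card + Module.finrank ℂ (Y₁.map M) + Module.finrank ℂ (Y₂.map
        (mask (Finset.univ.filter fun i : Fin 3 → ι => i t ∉ I t))) ≤ Module.finrank ℂ R + d := by
      omega
    exact_mod_cast this
  have hJ' : 3 * (Fintype.card J : ℝ) = (Fintype.card ι : ℝ) ^ 2 := by exact_mod_cast hJ
  have hn' : (0 : ℝ) < Fintype.card ι := by exact_mod_cast hn
  have f1 : (0 : ℝ) ≤ Module.finrank ℂ (Y₁.map M) := Nat.cast_nonneg _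
  have f2 : (0 : ℝ) ≤ Module.finrank ℂ (Y₂.map
        (mask (Finset.univ.filter fun i : Fin 3 → ι => i t ∉ I t))) := Nat.cast_nonneg _
  have hs := ha s
  have ht := ha t
  have hu := ha u
  have ps : (0 : ℝ) ≤ (I s).card := Nat.cast_nonneg _
  have pt : (0 : ℝ) ≤ (I t).card := Nat.cast_nonneg _
  have pu : (0 : ℝ) ≤ (I u).card := Nat.cast_nonneg _
  have pd : (0 : ℝ) ≤ d := Nat.cast_nonneg _
  generalize (Module.finrank ℂ (Y₁.map M) : ℝ) = F₁ at *
  generalize (Module.finrank ℂ (Y₂.map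
        (mask (Finset.univ.filter fun i : Fin 3 → ι => i t ∉ I t))) : ℝ) = F₂ at *
  generalize ((Fintype.card ι : ℕ) : ℝ) = n at *
  generalize ((Fintype.card J : ℕ) : ℝ) = j at *
  generalize ((I s).card : ℝ) = a at *
  generalize ((I t).card : ℝ) = b at *
  generalize ((I u).card : ℝ) = c at *
  generalize (d : ℝ) = δ at *
  suffices h : max 0 (a * b * (n - c) - 2 / 3 * n ^ 2 * b) +
      max 0 (a * c * (n - b) - 2 / 3 * n ^ 2 * c) ≤ F₁ + F₂ + δ by linarith
  have e1 : n * (a * b * (n - c) - 2 / 3 * n ^ 2 * b) ≤ n * F₁ + b * δ := by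
    rw [← hJ']
    linarith
  have e2 : n * (a * c * (n - b) - 2 / 3 * n ^ 2 * c) ≤ n * F₂ + c * δ := by
    rw [← hJ']
    linarith
  have b1 : b * δ ≤ n * δ := by gcongr
  have c1 : c * δ ≤ n * δ := by gcongr
  refine le_of_mul_le_mul_left ?_ hn'
  rcases le_total (a * b * (n - c) - 2 / 3 * n ^ 2 * b) 0 with g1 | g1
  · have : 0 ≤ n * F₁ := by positivity
    have : 0 ≤ n * F₂ := by positivity
    have : 0 ≤ n * δ := by positivity
    rw [max_eq_left g1, zero_add]
    rcases le_total (a * c * (n - b) - 2 / 3 * n ^ 2 * c) 0 with g2 | g2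
    · rw [max_eq_left g2]
      linarith
    · rw [max_eq_right g2]
      linarith
  · have : 0 ≤ n * F₁ := by positivity
    have : 0 ≤ n * F₂ := by positivity
    rw [max_eq_right g1]
    rcases le_total (a * c * (n - b) - 2 / 3 * n ^ 2 * c) 0 with g2 | g2
    · rw [max_eq_left g2]
      linarith
    · rw [max_eq_right g2]
      rcases pt.eq_or_lt with hb0 | hb0
      · subst hb0
        linarith
      rcases pu.eq_or_lt with hc0 | hc0
      · subst hc0
        linarith
      have g1' : 2 / 3 * n ^ 2 ≤ a * (n - c) := by
        refine le_of_mul_le_mul_left ?_ hb0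
        linarith
      have g2' : 2 / 3 * n ^ 2 ≤ a * (n - b) := by
        refine le_of_mul_le_mul_left ?_ hc0
        linarith
      have : a * (n - c) ≤ n * (n - c) := by
        gcongr
      have : a * (n - b) ≤ n * (n - b) := by
        gcongr
      have hbc : b + c ≤ n := by
        refine le_of_mul_le_mul_left ?_ hn'
        nlinarith
      have : (b + c) * δ ≤ n * δ := by gcongr
      linarith

end Bounds

theorem sum_erase_pureTensor_apply {ι : Type*} {s t u : Fin 3} (hst : s ≠ t) (hsu : s ≠ u) (htu : t ≠ u)
    (x x' : Fin 3 → ι → ℂ) (q : ι → ℂ) (i : Fin 3 → ι) :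
    (pureTensor (Function.update x s q) + ∑ t ∈ Finset.univ.erase s,
      pureTensor (Function.update (Function.update x t (x' t - x t)) s q)) i =
      q (i s) * (x' t (i t) * x' u (i u) -
        (x' t (i t) - x t (i t)) * (x' u (i u) - x u (i u))) := by
  rw [erase_eq_pair hst hsu htu, Finset.sum_pair htu, Pi.add_apply, Pi.add_apply,
    pureTensor_update_eq hst hsu htu, pureTensor_update_eq hst hsu htu,
    pureTensor_update_eq hst hsu htu, Function.update_self, Function.update_self,
    Function.update_of_ne htu.symm, Function.update_of_ne htu]
  simp only [Pi.sub_apply]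
  ring

section Main

variable {ι J : Type*} [Fintype ι] [DecidableEq ι] [Fintype J]

theorem mul_max_mu_le_finrank_add {X X' : J → Fin 3 → ι → ℂ} {d : ℕ} (hn : 0 < Fintype.card ι)
    (hJ : 3 * Fintype.card J = Fintype.card ι ^ 2)
    (hX : Fintype.card ι ^ 3 ≤ Module.finrank ℂ (LinearMap.range (pureTangent X)) + d)
    (hX' : Fintype.card ι ^ 3 ≤ Module.finrank ℂ (LinearMap.range (pureTangent X')) + d)
    (I : Fin 3 → Finset ι) (hXX' : ∀ j s, ∀ i ∉ I s, X' j s i = X j s i)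
    {R : Submodule ℂ ((Fin 3 → ι) → ℂ)}
    (hP : ∀ j s v, (∀ i ∉ I s, v i = 0) → pureTensor (Function.update (X j) s v) ∈ R)
    (hQ : ∀ j s q, pureTensor (Function.update (X j) s q) + ∑ t ∈ Finset.univ.erase s,
      pureTensor (Function.update (Function.update (X j) t (X' j t - X j t)) s q) ∈ R) :
    (Fintype.card ι : ℝ) ^ 3 *
      max (mu1 ((I 0).card / Fintype.card ι) ((I 1).card / Fintype.card ι)
          ((I 2).card / Fintype.card ι))
        (mu2 ((I 0).card / Fintype.card ι) ((I 1).card / Fintype.card ι)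
          ((I 2).card / Fintype.card ι)) ≤ Module.finrank ℂ R + 2 * d := by
  have hother (s : Fin 3) : ∃ t u, s ≠ t ∧ s ≠ u ∧ t ≠ u := by
    revert s
    decide
  have hm1 := card_piFinset_compl_add_le hJ hX I hP fun j s q => by
    refine ⟨_, hQ j s q, fun i hi => ?_⟩
    obtain ⟨t, u, hst, hsu, htu⟩ := hother s
    rw [sum_erase_pureTensor_apply hst hsu htu, hXX' j t _ (hi t), hXX' j u _ (hi u),
      pureTensor_update_eq hst hsu htu]
    ring
  have hm2 {s t u : Fin 3} (hst : s ≠ t) (hsu : s ≠ u) (htu : t ≠ u) :=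
    card_atMostOne_add_le hst hsu htu hn hJ hX hX' I hP fun j s q => by
      refine ⟨_, hQ j s q, fun i hi => ?_⟩
      obtain ⟨t, u, hst, hsu, htu⟩ := hother s
      rw [sum_erase_pureTensor_apply hst hsu htu, pureTensor_update_eq hst hsu htu]
      by_cases h : i t ∈ I t
      · rw [hXX' j u _ ((Finset.mem_filter.1 hi).2 t u htu h)]
        ring
      · rw [hXX' j t _ h]
        ring
  have hc (x : Fin 3) : ((I x)ᶜ.card : ℝ) = Fintype.card ι - (I x).card := by
    rw [Finset.card_compl, Nat.cast_sub (Finset.card_le_univ _)]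
  have hcard : ((atMostOne I).card : ℝ) = _ := congrArg (Nat.cast (R := ℝ)) (card_atMostOne
    (show (0 : Fin 3) ≠ 1 by decide) (show (0 : Fin 3) ≠ 2 by decide)
    (show (1 : Fin 3) ≠ 2 by decide) I)
  push_cast [hc] at hcard
  have hm1' : ((∏ s, (I s)ᶜ.card + Fintype.card J * ∑ s, (I s).card : ℕ) : ℝ) ≤
    (Module.finrank ℂ R + 2 * d : ℕ) := Nat.cast_le.2 hm1
  push_cast [hc, Fin.prod_univ_three, Fin.sum_univ_three] at hm1'
  have ha (x : Fin 3) : ((I x).card : ℝ) ≤ Fintype.card ι := by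
    exact_mod_cast Finset.card_le_univ _
  have hJ' : (Fintype.card J : ℝ) = (Fintype.card ι : ℝ) ^ 2 / 3 := by
    have : 3 * (Fintype.card J : ℝ) = (Fintype.card ι : ℝ) ^ 2 := by exact_mod_cast hJ
    linarith
  rw [hJ'] at hm1'
  have hn' : (0 : ℝ) < Fintype.card ι := by exact_mod_cast hn
  have m01 := hm2 (show (0 : Fin 3) ≠ 1 by decide) (show (0 : Fin 3) ≠ 2 by decide)
    (show (1 : Fin 3) ≠ 2 by decide)
  have m10 := hm2 (show (1 : Fin 3) ≠ 0 by decide) (show (1 : Fin 3) ≠ 2 by decide)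
    (show (0 : Fin 3) ≠ 2 by decide)
  have m20 := hm2 (show (2 : Fin 3) ≠ 0 by decide) (show (2 : Fin 3) ≠ 1 by decide)
    (show (0 : Fin 3) ≠ 1 by decide)
  have p0 : (0 : ℝ) ≤ (I 0).card := Nat.cast_nonneg _
  have p1 : (0 : ℝ) ≤ (I 1).card := Nat.cast_nonneg _
  have p2 : (0 : ℝ) ≤ (I 2).card := Nat.cast_nonneg _
  have q0 := ha 0
  have q1 := ha 1
  have q2 := ha 2
  clear hm2 hc ha hJ' hm1 hother hP hQ hX hX' hXX'
  rw [hcard] at m01 m10 m20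
  clear hcard
  generalize ((Fintype.card ι : ℕ) : ℝ) = n at *
  generalize ((I 0).card : ℝ) = a at *
  generalize ((I 1).card : ℝ) = b at *
  generalize ((I 2).card : ℝ) = c at *
  generalize (Module.finrank ℂ R : ℝ) + 2 * (d : ℝ) = F at *
  have hmin (x y : ℝ) : 2 / 3 * n ^ 2 * min x y = n ^ 3 * (2 / 3 * min (x / n) (y / n)) := by
    rw [min_div_div_right hn'.le]
    field_simp
  have hpair (x y z : ℝ) : n ^ 3 * max 0 (x / n * (y / n) * (1 - z / n) -
      2 / 3 * min (x / n) (y / n)) = max 0 (x * y * (n - z) - 2 / 3 * n ^ 2 * min x y) := by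
    rw [mul_max_of_nonneg _ _ (by positivity), mul_zero, mul_sub, ← hmin]
    congr 2
    field_simp
  have hzero (x y z : ℝ) (hx : 0 ≤ x) (hy : 0 ≤ y) (hxz : x ≤ z) (hyz : y ≤ z) :
      max 0 (x * y * (n - z) - 2 / 3 * n ^ 2 * min x y) = 0 := by
    refine max_eq_left ?_
    have hz : 0 ≤ z := hx.trans hxz
    have hq : z * (n - z) ≤ 2 / 3 * n ^ 2 := by nlinarith [sq_nonneg (n - 2 * z)]
    have key (v w : ℝ) (hv : 0 ≤ v) (hw : 0 ≤ w) (hwz : w ≤ z) :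
        v * (w * (n - z)) ≤ v * (2 / 3 * n ^ 2) := by
      refine mul_le_mul_of_nonneg_left ?_ hv
      rcases le_total z n with h | h
      · exact (mul_le_mul_of_nonneg_right hwz (by linarith)).trans hq
      · exact (mul_nonpos_of_nonneg_of_nonpos hw (by linarith)).trans (by positivity)
    rcases le_total x y with h | h
    · rw [min_eq_left h]
      linarith [key x y hx hy hyz]
    · rw [min_eq_right h]
      linarith [key y x hy hx hxz]
  rw [mul_max_of_nonneg _ _ (by positivity)]
  refine max_le ?_ ?_
  · refine le_trans (le_of_eq ?_) hm1'
    rw [mu1]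
    field_simp
    ring
  · have hmu : n ^ 3 * mu2 (a / n) (b / n) (c / n) =
        (n - a) * ((n - b) * (n - c)) + a * ((n - b) * (n - c)) + (n - a) * (b * (n - c)) +
        (n - a) * ((n - b) * c) + max 0 (a * b * (n - c) - 2 / 3 * n ^ 2 * min a b) +
        max 0 (a * c * (n - b) - 2 / 3 * n ^ 2 * min a c) +
        max 0 (b * c * (n - a) - 2 / 3 * n ^ 2 * min b c) := by
      rw [← hpair, ← hpair, ← hpair, mu2]
      field_simp
    rw [hmu]
    rcases le_total b a with hba | hba
    · rcases le_total c a with hca | hca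
      · rw [hzero b c a p1 p2 hba hca, min_eq_right hba, min_eq_right hca]
        linarith
      · rw [hzero a b c p0 p1 hca (hba.trans hca), min_eq_left hca, min_eq_left (hba.trans hca),
          mul_comm a c, mul_comm b c]
        linarith
    · rcases le_total c b with hcb | hcb
      · rw [hzero a c b p0 p2 hba hcb, min_eq_left hba, min_eq_right hcb, mul_comm a b]
        linarith
      · rw [hzero a b c p0 p1 (hba.trans hcb) hcb, min_eq_left (hba.trans hcb), min_eq_left hcb,
          mul_comm a c, mul_comm b c]
        linarith

end Main

/-- The map between tensor cubes induced by a triple of linear maps. -/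
noncomputable def tensorMap {ι κ : Type*} [Fintype ι] [DecidableEq ι]
    (f : Fin 3 → (ι → ℂ) →ₗ[ℂ] (κ → ℂ)) : ((Fin 3 → ι) → ℂ) →ₗ[ℂ] ((Fin 3 → κ) → ℂ) where
  toFun T k := ∑ i, (∏ s, f s (Pi.single (i s) 1) (k s)) * T i
  map_add' T T' := by
    ext k
    simp [mul_add, Finset.sum_add_distrib]
  map_smul' c T := by
    ext k
    simp only [Pi.smul_apply, smul_eq_mul, RingHom.id_apply, Finset.mul_sum]
    exact Finset.sum_congr rfl fun i _ => by ring

section Reduction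

variable {ι κ : Type*} [Fintype ι] [DecidableEq ι]

theorem tensorMap_pureTensor (f : Fin 3 → (ι → ℂ) →ₗ[ℂ] (κ → ℂ)) (v : Fin 3 → ι → ℂ) :
    tensorMap f (pureTensor v) = pureTensor fun s => f s (v s) := by
  ext k
  simp only [tensorMap, LinearMap.coe_mk, AddHom.coe_mk, pureTensor, ← Finset.prod_mul_distrib]
  rw [← Fintype.piFinset_univ, ← Finset.prod_univ_sum (fun _ => Finset.univ)
    (fun s a => f s (Pi.single a 1) (k s) * v s a)]
  refine Finset.prod_congr rfl fun s _ => ?_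
  rw [LinearMap.pi_apply_eq_sum_univ (f s) (v s), Finset.sum_apply]
  refine Finset.sum_congr rfl fun a _ => ?_
  have : (fun j => if a = j then (1 : ℂ) else 0) = Pi.single a 1 := by
    ext j
    simp [Pi.single_apply, eq_comm]
  rw [this, Pi.smul_apply, smul_eq_mul, mul_comm]

theorem tensorMap_pureTensor_update (f : Fin 3 → (ι → ℂ) →ₗ[ℂ] (κ → ℂ)) (v : Fin 3 → ι → ℂ)
    (s : Fin 3) (w : ι → ℂ) :
    tensorMap f (pureTensor (Function.update v s w)) =
      pureTensor (Function.update (fun s => f s (v s)) s (f s w)) := by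
  rw [tensorMap_pureTensor]
  congr 1
  ext1 t
  exact Function.apply_update (fun t => f t) v s w t

theorem finrank_range_pureTangent_le {J : Type*} [Fintype J] (Z : J → Fin 3 → ι → ℂ)
    (g : Fin 3 → (ι → ℂ) ≃ₗ[ℂ] (ι → ℂ)) :
    Module.finrank ℂ (LinearMap.range (pureTangent Z)) ≤
      Module.finrank ℂ (LinearMap.range (pureTangent fun j s => g s (Z j s))) := by
  refine (Submodule.finrank_mono ?_).trans
    (Submodule.finrank_map_le (tensorMap fun s => ((g s).symm : (ι → ℂ) →ₗ[ℂ] (ι → ℂ))) _)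
  rintro _ ⟨c, rfl⟩
  refine ⟨pureTangent (fun j s => g s (Z j s)) fun j s => g s (c j s), ⟨_, rfl⟩, ?_⟩
  simp [pureTangent_eq, map_sum, tensorMap_pureTensor_update]

theorem Submodule.exists_equiv_mem_iff (V : Submodule ℂ (ι → ℂ)) :
    ∃ (g : (ι → ℂ) ≃ₗ[ℂ] (ι → ℂ)) (I : Finset ι), ∀ v, v ∈ V ↔ ∀ i ∉ I, g v i = 0 := by
  obtain ⟨C, hC⟩ := V.exists_isCompl
  let B := ((Module.finBasis ℂ V).prod (Module.finBasis ℂ C)).map (V.prodEquivOfIsCompl C hC)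
  let e := Fintype.equivOfCardEq (α := Fin (Module.finrank ℂ V) ⊕ Fin (Module.finrank ℂ C))
    (β := ι) (by rw [← Module.finrank_eq_card_basis B, Module.finrank_fintype_fun_eq_card])
  refine ⟨(B.reindex e).equivFun, Finset.univ.image fun a => e (Sum.inl a), fun v => ?_⟩
  rw [← Submodule.prodEquivOfIsCompl_symm_apply_snd_eq_zero V C hC,
    ← (Module.finBasis ℂ C).repr.map_eq_zero_iff, Finsupp.ext_iff]
  have hval (b) : (B.reindex e).equivFun v (e (Sum.inr b)) =
      (Module.finBasis ℂ C).repr ((V.prodEquivOfIsCompl C hC).symm v).2 b := by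
    simp [B]
  constructor
  · intro h i hi
    obtain ⟨a | b, rfl⟩ := e.surjective i
    · exact absurd (Finset.mem_image_of_mem _ (Finset.mem_univ a)) hi
    · rw [hval, h]
      rfl
  · intro h b
    rw [← hval]
    refine h _ fun hb => ?_
    obtain ⟨a, -, ha⟩ := Finset.mem_image.1 hb
    exact Sum.inl_ne_inr (e.injective ha)

theorem muMin_le_max {a b c : ℝ} (ha : a ∈ Set.Icc (0 : ℝ) 1) (hb : b ∈ Set.Icc (0 : ℝ) 1)
    (hc : c ∈ Set.Icc (0 : ℝ) 1) : muMin ≤ max (mu1 a b c) (mu2 a b c) := by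
  refine csInf_le ⟨0, ?_⟩ ⟨a, ha, b, hb, c, hc, rfl⟩
  rintro _ ⟨a, ⟨ha, ha'⟩, b, ⟨hb, hb'⟩, c, ⟨hc, hc'⟩, rfl⟩
  refine le_max_of_le_left ?_
  have h1 : 0 ≤ 1 - a := by linarith
  have h2 : 0 ≤ 1 - b := by linarith
  have h3 : 0 ≤ 1 - c := by linarith
  rw [mu1]
  positivity

theorem pow_mul_muMin_le_finrank_add [Fintype κ] [DecidableEq κ] {J : Type*} [Fintype J]
    {x ξ : J → Fin 3 → κ → ℂ} (Ψ : Fin 3 → (κ → ℂ) →ₗ[ℂ] (κ → ℂ))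
    {A : (κ → ℂ) →ₗ[ℂ] (ι → ℂ)} (hA : Function.Surjective A) {d : ℕ}
    (hn : 0 < Fintype.card ι) (hJ : 3 * Fintype.card J = Fintype.card ι ^ 2)
    (hX : Fintype.card ι ^ 3 ≤ Module.finrank ℂ
      (LinearMap.range (pureTangent fun j s => A (x j s))) + d)
    (hX' : Fintype.card ι ^ 3 ≤ Module.finrank ℂ
      (LinearMap.range (pureTangent fun j s => A (x j s + Ψ s (ξ j s)))) + d)
    {W : Submodule ℂ ((Fin 3 → κ) → ℂ)}
    (hP : ∀ j s v, pureTensor (Function.update (x j) s (Ψ s v)) ∈ W)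
    (hQ : ∀ j s q, pureTensor (Function.update (x j) s q) + ∑ t ∈ Finset.univ.erase s,
      pureTensor (Function.update (Function.update (x j) t (Ψ t (ξ j t))) s q) ∈ W) :
    (Fintype.card ι : ℝ) ^ 3 * muMin ≤ Module.finrank ℂ W + 2 * d := by
  choose g I hg using fun s => (LinearMap.range (A ∘ₗ Ψ s)).exists_equiv_mem_iff
  let M (s : Fin 3) : (κ → ℂ) →ₗ[ℂ] (ι → ℂ) := (g s : (ι → ℂ) →ₗ[ℂ] (ι → ℂ)) ∘ₗ A
  have hM (s) : Function.Surjective (M s) := (g s).surjective.comp hA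
  have key := mul_max_mu_le_finrank_add (X := fun j s => M s (x j s))
    (X' := fun j s => M s (x j s + Ψ s (ξ j s))) (R := W.map (tensorMap M)) (d := d) hn hJ
    (hX.trans (Nat.add_le_add_right
      (finrank_range_pureTangent_le (fun j s => A (x j s)) g) _))
    (hX'.trans (Nat.add_le_add_right
      (finrank_range_pureTangent_le (fun j s => A (x j s + Ψ s (ξ j s))) g) _)) I
    (fun j s i hi => by
      rw [map_add, Pi.add_apply, add_eq_left]
      exact (hg s _).1 ⟨ξ j s, rfl⟩ i hi)
    (fun j s v hv => by
      obtain ⟨w, hw⟩ := (hg s ((g s).symm v)).2 (by simpa using hv)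
      refine ⟨_, hP j s w, ?_⟩
      rw [tensorMap_pureTensor_update]
      have : M s (Ψ s w) = v := (congrArg (g s) hw).trans ((g s).apply_symm_apply v)
      rw [this])
    (fun j s q => by
      obtain ⟨q, rfl⟩ := hM s q
      refine ⟨_, hQ j s q, ?_⟩
      rw [map_add, map_sum, tensorMap_pureTensor_update]
      congr 1
      refine Finset.sum_congr rfl fun t _ => ?_
      rw [tensorMap_pureTensor_update]
      congr 2
      ext1 y
      rw [map_add, add_sub_cancel_left]
      exact Function.apply_update (fun t => M t) (x j) t (Ψ t (ξ j t)) y)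
  have hI (s) : ((I s).card : ℝ) / Fintype.card ι ∈ Set.Icc (0 : ℝ) 1 :=
    ⟨by positivity, div_le_one_of_le₀ (by exact_mod_cast Finset.card_le_univ _) (by positivity)⟩
  have h1 := mul_le_mul_of_nonneg_left (muMin_le_max (hI 0) (hI 1) (hI 2))
    (show (0 : ℝ) ≤ (Fintype.card ι : ℝ) ^ 3 by positivity)
  have h2 : (Module.finrank ℂ (W.map (tensorMap M)) : ℝ) ≤ Module.finrank ℂ W :=
    Nat.cast_le.2 (Submodule.finrank_map_le _ _)
  linarith

end Reduction

theorem cube_mul_muMin_le_finrank_add {r m K q : ℕ} (hq : 0 < q) (hK : m = K + 3 * q)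
    {x ξ : Fin r → Fin 3 → Fin m → ℂ}
    (hp : AlgebraicIndependent ℚ
      (Sum.elim (fun i : Fin r × Fin 3 × Fin m => x i.1 i.2.1 i.2.2)
        (fun i : Fin r × Fin 3 × Fin m => ξ i.1 i.2.1 i.2.2)))
    (hr : 3 * q ^ 2 * (K + 1) + 3 * m ^ 2 ≤ r * (K + 1))
    (Ψ : Fin 3 → Matrix (Fin m) (Fin m) ℂ) {W : Submodule ℂ ((Fin 3 → Fin m) → ℂ)}
    (hP : ∀ α s v, pureTensor (Function.update (x α) s ((Ψ s).mulVec v)) ∈ W)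
    (hQ : ∀ α s q, pureTensor (Function.update (x α) s q) + ∑ t ∈ Finset.univ.erase s,
      pureTensor (Function.update (Function.update (x α) t ((Ψ t).mulVec (ξ α t))) s q) ∈ W) :
    (3 * q : ℝ) ^ 3 * muMin ≤ Module.finrank ℂ W + 6 * (3 * q : ℝ) ^ 2 := by
  obtain ⟨J, hJ, A, hA, h1, h2⟩ :=
    exists_projection_algebraicIndependent (K := K) (by omega) hp Ψ
  have : NeZero q := ⟨hq.ne'⟩
  have hJ' : 3 * q ^ 2 ≤ J.card := by
    refine Nat.le_of_mul_le_mul_right (c := K + 1) ?_ (by omega)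
    omega
  have hcG : Fintype.card (ZMod q) = q := ZMod.card q
  have hcJ : Fintype.card (Cell (ZMod q) × Fin 3) = 3 * q ^ 2 := by
    rw [Fintype.card_prod, card_cell, hcG, Fintype.card_fin, mul_comm]
  have hcι : Fintype.card (ZMod q × Fin 3) = 3 * q := by
    rw [Fintype.card_prod, hcG, Fintype.card_fin, mul_comm]
  obtain ⟨φ⟩ : Nonempty (Cell (ZMod q) × Fin 3 ↪ J) :=
    Function.Embedding.nonempty_of_card_le (by rwa [hcJ, Fintype.card_coe])
  let e : ZMod q × Fin 3 ≃ Fin (m - K) :=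
    Fintype.equivOfCardEq (by rw [hcι, Fintype.card_fin]; omega)
  let A' : (Fin m → ℂ) →ₗ[ℂ] (ZMod q × Fin 3 → ℂ) := LinearMap.funLeft ℂ ℂ e ∘ₗ A.mulVecLin
  have hA' : Function.Surjective A' :=
    (LinearMap.funLeft_surjective_of_injective ℂ ℂ e e.injective).comp hA
  let ρ : (Cell (ZMod q) × Fin 3) × Fin 3 × ZMod q × Fin 3 → J × Fin 3 × Fin (m - K) :=
    Prod.map φ (Prod.map id e)
  have hρ : Function.Injective ρ :=
    φ.injective.prodMap (Function.injective_id.prodMap e.injective)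
  have key := pow_mul_muMin_le_finrank_add (x := fun j => x (φ j)) (ξ := fun j => ξ (φ j))
    (fun s => (Ψ s).mulVecLin) hA' (d := 27 * q ^ 2) (by omega)
    (by rw [hcJ, hcι]; ring)
    (by
      have := le_finrank_range_pureTangent (X := fun j s => A' (x (φ j) s)) (h1.comp ρ hρ)
      rw [hcι]
      rw [hcG] at this
      refine le_trans (le_of_eq ?_) this
      ring)
    (by
      have := le_finrank_range_pureTangent
        (X := fun j s => A' (x (φ j) s + (Ψ s).mulVecLin (ξ (φ j) s))) (h2.comp ρ hρ)
      rw [hcι]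
      rw [hcG] at this
      refine le_trans (le_of_eq ?_) this
      ring)
    (fun j => hP (φ j)) (fun j => hQ (φ j))
  rw [hcι] at key
  push_cast at key
  refine key.trans (le_of_eq ?_)
  ring

theorem IsOpen.exists_algebraicIndependent_coordinates {r m : ℕ}
    {U : Set (Fin r → Fin 6 → Fin m → ℂ)} (hU : IsOpen U) (hne : U.Nonempty) :
    ∃ p ∈ U, AlgebraicIndependent ℚ
      (Sum.elim (fun i : Fin r × Fin 3 × Fin m => p i.1 (Fin.castAdd 3 i.2.1) i.2.2)
        (fun i : Fin r × Fin 3 × Fin m => p i.1 (Fin.natAdd 3 i.2.1) i.2.2)) := by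
  let F (w : (Fin r × Fin 3 × Fin m) ⊕ (Fin r × Fin 3 × Fin m) → ℂ) :
      Fin r → Fin 6 → Fin m → ℂ :=
    fun α s i => w (Sum.map (fun a => (α, a, i)) (fun b => (α, b, i))
      ((finSumFinEquiv (m := 3) (n := 3)).symm s))
  have hF : Continuous F := by fun_prop
  have hF' : Function.Surjective F := by
    intro p
    refine ⟨Sum.elim (fun i => p i.1 (Fin.castAdd 3 i.2.1) i.2.2)
      fun i => p i.1 (Fin.natAdd 3 i.2.1) i.2.2, ?_⟩
    ext α s i
    obtain ⟨a | b, rfl⟩ := (finSumFinEquiv (m := 3) (n := 3)).surjective s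
    · simp only [F, Equiv.symm_apply_apply]
      rfl
    · simp only [F, Equiv.symm_apply_apply]
      rfl
  obtain ⟨w, hw, hind⟩ := (hU.preimage hF).exists_algebraicIndependent (hne.preimage hF')
  refine ⟨F w, hw, ?_⟩
  convert hind using 1
  ext (⟨α, a, i⟩ | ⟨α, b, i⟩)
  · simp only [F, Sum.elim_inl, finSumFinEquiv_symm_apply_castAdd]
    rfl
  · simp only [F, Sum.elim_inr, finSumFinEquiv_symm_apply_natAdd]
    rfl

theorem muMin_le : muMin ≤ 31 / 50 := by
  have h : (21 / 50 : ℝ) ∈ Set.Icc (0 : ℝ) 1 := by constructor <;> norm_num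
  refine (muMin_le_max h h h).trans (max_le ?_ ?_)
  · norm_num [mu1]
  · norm_num [mu2]

theorem le_Lminus {k m : ℕ} (hk : 0 < k) (hk' : k ≤ 8) (hm : 150 * k < 31 * m) :
    31 / 50 ≤ Lminus k m := by
  refine le_max_of_le_left ?_
  have key (m₀ : ℕ) (h : m₀ ≤ m) : ∃ t : ℝ, 0 ≤ t ∧ (m : ℝ) = m₀ + t :=
    ⟨m - m₀, by
      have : (m₀ : ℝ) ≤ m := by exact_mod_cast h
      linarith, by ring⟩
  obtain ⟨t, ht, hmt⟩ := key (150 * k / 31 + 1) (by omega)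
  rw [hmt]
  clear hmt key
  rw [le_sub_comm]
  interval_cases k <;> norm_num <;> rw [div_le_iff₀ (by
    refine mul_pos (by positivity) ?_
    linarith)] <;> ring_nf <;> nlinarith [pow_nonneg ht 2, pow_nonneg ht 3]

theorem le_rme_mul {k m K n : ℕ} {ε : ℝ} (hkm : k < m) (hL : Lminus k m ≤ ε) (hK : k ≤ K)
    (hn : m = K + 3 * n) :
    3 * n ^ 2 * (K + 1) + 3 * m ^ 2 ≤ rme m ε * (K + 1) := by
  have h1 := (le_max_left _ _).trans hL
  have h2 : (1 + ε) * (m : ℝ) ^ 2 / 3 ≤ rme m ε := Nat.le_ceil _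
  have hkm' : (k : ℝ) + 1 ≤ m := by exact_mod_cast hkm
  have hKr : (k : ℝ) ≤ K := by exact_mod_cast hK
  have hnr : (m : ℝ) = K + 3 * n := by exact_mod_cast hn
  have hk0 : (0 : ℝ) ≤ k := Nat.cast_nonneg _
  have hn0 : (0 : ℝ) ≤ n := Nat.cast_nonneg _
  suffices h : (3 * n ^ 2 * (K + 1) + 3 * m ^ 2 : ℝ) ≤ rme m ε * (K + 1) by exact_mod_cast h
  have hD : 0 < 3 * (m : ℝ) - 3 * k - 2 := by linarith
  have hm0 : (0 : ℝ) < m := by linarith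
  have hK0 : (0 : ℝ) < K + 1 := by linarith
  have h3 : 3 * (m : ℝ) ^ 2 / (k + 1) + ((m - k : ℝ) ^ 3 / (3 * (m : ℝ) - 3 * k - 2) + 1) ≤
      (1 + ε) * (m : ℝ) ^ 2 / 3 := by
    refine le_trans (le_of_eq ?_)
      (show (1 + (9 / ((k : ℝ) + 1) - ((6 * (k : ℝ) - 2) * (m : ℝ) ^ 2 -
        (9 * (k : ℝ) ^ 2 + 9) * (m : ℝ) + (3 * (k : ℝ) ^ 3 + 9 * (k : ℝ) + 6)) /
        ((m : ℝ) ^ 2 * (3 * (m : ℝ) - 3 * (k : ℝ) - 2)))) * (m : ℝ) ^ 2 / 3 ≤ _ by gcongr)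
    generalize hDe : 3 * (m : ℝ) - 3 * k - 2 = D at *
    have hme : (m : ℝ) = (D + 3 * k + 2) / 3 := by linarith
    have hk1 : (k : ℝ) + 1 ≠ 0 := by positivity
    field_simp
    rw [hme]
    ring
  have h4 : 3 * (n : ℝ) ^ 2 ≤ (m - k : ℝ) ^ 3 / (3 * (m : ℝ) - 3 * k - 2) := by
    rw [le_div_iff₀ hD]
    have h5 : 3 * (n : ℝ) ≤ m - k := by linarith
    have h6 : (3 * (n : ℝ)) ^ 2 ≤ (m - k : ℝ) ^ 2 := by gcongr
    nlinarith
  have h7 : 3 * (m : ℝ) ^ 2 / (K + 1) ≤ 3 * (m : ℝ) ^ 2 / (k + 1) := by gcongr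
  calc (3 * n ^ 2 * (K + 1) + 3 * m ^ 2 : ℝ)
      = (3 * (m : ℝ) ^ 2 / (K + 1) + 3 * (n : ℝ) ^ 2) * (K + 1) := by field_simp; ring
    _ ≤ rme m ε * (K + 1) := by
      gcongr
      linarith

theorem cube_mul_muMin_le_finrank_sup {r m K n : ℕ} (hn : 0 < n) (hK : m = K + 3 * n)
    {p : Fin r → Fin 6 → Fin m → ℂ}
    (hp : AlgebraicIndependent ℚ
      (Sum.elim (fun i : Fin r × Fin 3 × Fin m => p i.1 (Fin.castAdd 3 i.2.1) i.2.2)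
        (fun i : Fin r × Fin 3 × Fin m => p i.1 (Fin.natAdd 3 i.2.1) i.2.2)))
    (hr : 3 * n ^ 2 * (K + 1) + 3 * m ^ 2 ≤ r * (K + 1)) (ΨA ΨB ΨC : Fin m → Fin m → ℂ) :
    (3 * n : ℝ) ^ 3 * muMin ≤ Module.finrank ℂ
      ↥(Psp (fun α => p α 0) (fun α => p α 1) (fun α => p α 2) ΨA ΨB ΨC ⊔
        Qsp (fun α => p α 0) (fun α => p α 1) (fun α => p α 2)
          (fun α => p α 3) (fun α => p α 4) (fun α => p α 5) ΨA ΨB ΨC) +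
      6 * (3 * n : ℝ) ^ 2 := by
  set V := Psp (fun α => p α 0) (fun α => p α 1) (fun α => p α 2) ΨA ΨB ΨC ⊔
        Qsp (fun α => p α 0) (fun α => p α 1) (fun α => p α 2)
          (fun α => p α 3) (fun α => p α 4) (fun α => p α 5) ΨA ΨB ΨC with hV
  have hPV {T} (h : T ∈ Psp (fun α => p α 0) (fun α => p α 1) (fun α => p α 2) ΨA ΨB ΨC) :
      T ∈ V := Submodule.mem_sup_left h
  have hQV {T} (h : T ∈ Qsp (fun α => p α 0) (fun α => p α 1) (fun α => p α 2)
          (fun α => p α 3) (fun α => p α 4) (fun α => p α 5) ΨA ΨB ΨC) :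
      T ∈ V := Submodule.mem_sup_right h
  let e : (Fin m × Fin m × Fin m → ℂ) →ₗ[ℂ] ((Fin 3 → Fin m) → ℂ) :=
    LinearMap.funLeft ℂ ℂ (tripleEquiv (Fin m))
  have h01 : (0 : Fin 3) ≠ 1 := by decide
  have h02 : (0 : Fin 3) ≠ 2 := by decide
  have h12 : (1 : Fin 3) ≠ 2 := by decide
  have key := cube_mul_muMin_le_finrank_add hn hK (x := fun α s => p α (Fin.castAdd 3 s))
    (ξ := fun α s => p α (Fin.natAdd 3 s)) hp hr
    (fun s => Matrix.of (![ΨA, ΨB, ΨC] s)) (W := V.map e)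
    (by
      intro α s v
      fin_cases s
      · refine ⟨_, hPV (Submodule.subset_span (Or.inl (Or.inl ⟨v, α, rfl⟩))), ?_⟩
        ext i
        simp only [Fin.zero_eta, pureTensor_update_eq h01 h02 h12]
        exact mul_assoc _ _ _
      · refine ⟨_, hPV (Submodule.subset_span (Or.inl (Or.inr ⟨v, α, rfl⟩))), ?_⟩
        ext i
        simp only [Fin.mk_one, pureTensor_update_eq h01.symm h12 h02]
        exact (mul_assoc _ _ _).trans (mul_left_comm _ _ _)
      · refine ⟨_, hPV (Submodule.subset_span (Or.inr ⟨v, α, rfl⟩)), ?_⟩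
        ext i
        simp only [Fin.reduceFinMk, pureTensor_update_eq h02.symm h12.symm h01]
        exact mul_comm _ _)
    (by
      intro α s q
      fin_cases s
      · refine ⟨_, hQV (Submodule.subset_span (Or.inl (Or.inl ⟨q, α, rfl⟩))), ?_⟩
        ext i
        simp only [Fin.zero_eta, erase_eq_pair h01 h02 h12, Finset.sum_pair h12, Pi.add_apply,
          pureTensor_update_eq h01 h02 h12, Function.update_self, Function.update_of_ne h12,
          Function.update_of_ne h12.symm]
        rw [← add_assoc, ← mul_assoc, ← mul_assoc, ← mul_assoc]
        rfl
      · refine ⟨_, hQV (Submodule.subset_span (Or.inl (Or.inr ⟨q, α, rfl⟩))), ?_⟩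
        ext i
        simp only [Fin.mk_one, erase_eq_pair h01.symm h12 h02, Finset.sum_pair h02, Pi.add_apply,
          pureTensor_update_eq h01.symm h12 h02, Function.update_self, Function.update_of_ne h02,
          Function.update_of_ne h02.symm]
        rw [← add_assoc, mul_left_comm, mul_left_comm (q _), mul_left_comm (q _), ← mul_assoc,
          ← mul_assoc, ← mul_assoc]
        rfl
      · refine ⟨_, hQV (Submodule.subset_span (Or.inr ⟨q, α, rfl⟩)), ?_⟩
        ext i
        simp only [Fin.reduceFinMk, erase_eq_pair h02.symm h12.symm h01, Finset.sum_pair h01,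
          Pi.add_apply, pureTensor_update_eq h02.symm h12.symm h01, Function.update_self,
          Function.update_of_ne h01, Function.update_of_ne h01.symm]
        rw [← add_assoc, mul_comm, mul_comm (q _), mul_comm (q _)]
        rfl)
  have hle : (Module.finrank ℂ (V.map e) : ℝ) ≤ Module.finrank ℂ V :=
    Nat.cast_le.2 (Submodule.finrank_map_le _ _)
  linarith

/-- **Lower bound for `dim(𝒫^p + 𝒬^p)`.** If `L⁻_{k,m} ≤ ε` and `ψ_A, ψ_B, ψ_C` are
differentiable maps on a nonempty (Euclidean) open set `U ⊆ 𝒱_{m,ε} = ℂ^{6m r_{m,ε}}`,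
then at some point `p̄ ∈ U` one has
`dim(𝒫^p̄ + 𝒬^p̄) ≥ m²(mμ − max{3k, mε})`.
A point `p ∈ 𝒱_{m,ε}` is a tuple `(xᵅ,yᵅ,zᵅ,ξᵅ,ηᵅ,τᵅ)`, encoded as
`p : Fin r_{m,ε} → Fin 6 → Fin m → ℂ` with `xᵅ = p α 0, …, τᵅ = p α 5`. -/
theorem exists_point_dim_P_sup_Q_ge (k m : ℕ) (hk : 0 < k) (hm : 0 < m)
    (hkm : k ≤ m - 1) (ε : ℝ) (hε : 0 < ε) (hL : Lminus k m ≤ ε)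
    (U : Set (Fin (rme m ε) → Fin 6 → Fin m → ℂ)) (hUopen : IsOpen U)
    (hUne : U.Nonempty)
    (ψA ψB ψC : (Fin (rme m ε) → Fin 6 → Fin m → ℂ) → (Fin m → Fin m → ℂ))
    (hψA : DifferentiableOn ℝ ψA U) (hψB : DifferentiableOn ℝ ψB U)
    (hψC : DifferentiableOn ℝ ψC U) :
    ∃ p ∈ U,
      (m : ℝ) ^ 2 * ((m : ℝ) * muMin - max (3 * (k : ℝ)) ((m : ℝ) * ε)) ≤
        (Module.finrank ℂ
          ↥(Psp (fun α => p α 0) (fun α => p α 1) (fun α => p α 2)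
              (ψA p) (ψB p) (ψC p) ⊔
            Qsp (fun α => p α 0) (fun α => p α 1) (fun α => p α 2)
              (fun α => p α 3) (fun α => p α 4) (fun α => p α 5)
              (ψA p) (ψB p) (ψC p)) : ℝ) := by
  obtain ⟨p, hpU, hp⟩ := hUopen.exists_algebraicIndependent_coordinates hUne
  refine ⟨p, hpU, ?_⟩
  have hm0 : (0 : ℝ) < m := by exact_mod_cast hm
  by_cases htriv : (m : ℝ) * muMin ≤ max (3 * (k : ℝ)) ((m : ℝ) * ε)
  · refine le_trans ?_ (Nat.cast_nonneg _)
    exact mul_nonpos_of_nonneg_of_nonpos (by positivity) (sub_nonpos.2 htriv)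
  rw [not_le, max_lt_iff] at htriv
  obtain ⟨h3k, hme⟩ := htriv
  have hμ := muMin_le
  have hεμ : ε < 31 / 50 := (lt_of_mul_lt_mul_left hme hm0.le).trans_le hμ
  have hmk : 150 * k < 31 * m := by
    have : (m : ℝ) * muMin ≤ m * (31 / 50) := by gcongr
    have : (150 * k : ℝ) < 31 * m := by linarith
    exact_mod_cast this
  have hk9 : 9 ≤ k := by
    by_contra h
    linarith [le_Lminus hk (by omega) hmk]
  obtain ⟨K, n, hn, hK, hkK, hKk⟩ : ∃ K n, 0 < n ∧ m = K + 3 * n ∧ k ≤ K ∧ K ≤ k + 2 :=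
    ⟨m - 3 * ((m - k) / 3), (m - k) / 3, by omega, by omega, by omega, by omega⟩
  have key := cube_mul_muMin_le_finrank_sup hn hK hp (le_rme_mul (by omega) hL hkK hK)
    (ψA p) (ψB p) (ψC p)
  have hmax := le_max_left (3 * (k : ℝ)) ((m : ℝ) * ε)
  have hmax' := mul_le_mul_of_nonneg_left hmax (sq_nonneg (m : ℝ))
  have hmK : (m : ℝ) = K + 3 * n := by exact_mod_cast hK
  have hKk' : (K : ℝ) ≤ k + 2 := by exact_mod_cast hKk
  have hk9' : (9 : ℝ) ≤ k := by exact_mod_cast hk9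
  have hK0 : (0 : ℝ) ≤ K := Nat.cast_nonneg _
  have hn0 : (0 : ℝ) ≤ 3 * n := by positivity
  have hcube : (m : ℝ) ^ 3 - (3 * n) ^ 3 ≤ 3 * (K * (m : ℝ) ^ 2) := by
    have : 0 ≤ (K : ℝ) ^ 2 * (2 * K + 3 * (3 * n)) := by positivity
    rw [hmK]
    linarith
  have hcube' : (3 * n : ℝ) ^ 3 ≤ (m : ℝ) ^ 3 := by
    gcongr
    linarith
  have hsq : (3 * n : ℝ) ^ 2 ≤ (m : ℝ) ^ 2 := by
    gcongr
    linarith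
  have h1 : ((m : ℝ) ^ 3 - (3 * n) ^ 3) * muMin ≤ ((m : ℝ) ^ 3 - (3 * n) ^ 3) * (31 / 50) :=
    mul_le_mul_of_nonneg_left hμ (by linarith)
  have h2 : (m : ℝ) ^ 2 * (93 / 50 * K + 6) ≤ (m : ℝ) ^ 2 * (3 * k) := by
    gcongr
    linarith
  linarith
end

section
/- There exist ε ∈ ℝ_{>0} and positive integers k, m̄ with k ≤ m̄ − 1 such that L^-_{k,m} ≤ ε < L^+_{k,m} for every integer m > m̄. -/
/-- `L⁺_{k,m}`. -/
noncomputable def Lplus (k m : ℕ) : ℝ :=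
  min ((2 * muMin - 1) +
      (2 * ((2 * muMin - 1) - 9 * (k : ℝ) - 8) * (m : ℝ) ^ 2 - 9 * (m : ℝ) + 6) /
        ((m : ℝ) ^ 2 * (3 * (m : ℝ) - 2)))
    ((2 * muMin - 1) / 3 +
      (2 * ((2 * muMin - 1) - 24) * (m : ℝ) ^ 2 - 27 * (m : ℝ) + 18) /
        (3 * (m : ℝ) ^ 2 * (9 * (m : ℝ) - 2)))

open Filter Topology

lemma three_mul_mu1_add_mu2 (a b g : ℝ) :
    2 + 2 * ((1 - a) * (1 - b) * (1 - g)) + a * b * g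
      + max 0 (a * b * (1 - g) - 2 / 3 * min a b)
      + max 0 (a * g * (1 - b) - 2 / 3 * min a g)
      + max 0 (b * g * (1 - a) - 2 / 3 * min b g) = 3 * mu1 a b g + mu2 a b g := by
  unfold mu1 mu2
  ring

lemma half_lt_max_mu1_mu2 {a b g : ℝ} (ha : a ∈ Set.Icc (0 : ℝ) 1) (hb : b ∈ Set.Icc (0 : ℝ) 1)
    (hg : g ∈ Set.Icc (0 : ℝ) 1) : 1 / 2 < max (mu1 a b g) (mu2 a b g) := by
  by_contra! h
  obtain ⟨h1, h2⟩ := max_le_iff.1 h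
  obtain ⟨ha0, ha1⟩ := ha
  obtain ⟨hb0, hb1⟩ := hb
  obtain ⟨hg0, hg1⟩ := hg
  have key := three_mul_mu1_add_mu2 a b g
  have hp : 0 ≤ (1 - a) * (1 - b) * (1 - g) :=
    mul_nonneg (mul_nonneg (sub_nonneg.2 ha1) (sub_nonneg.2 hb1)) (sub_nonneg.2 hg1)
  have hq : 0 ≤ a * b * g := by positivity
  have m1 := le_max_left 0 (a * b * (1 - g) - 2 / 3 * min a b)
  have m2 := le_max_left 0 (a * g * (1 - b) - 2 / 3 * min a g)
  have m3 := le_max_left 0 (b * g * (1 - a) - 2 / 3 * min b g)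
  have n1 := le_max_right 0 (a * b * (1 - g) - 2 / 3 * min a b)
  have n2 := le_max_right 0 (a * g * (1 - b) - 2 / 3 * min a g)
  have n3 := le_max_right 0 (b * g * (1 - a) - 2 / 3 * min b g)
  have hp0 : (1 - a) * (1 - b) * (1 - g) = 0 := by linarith
  have hq0 : a * b * g = 0 := by linarith
  have hs : a + b + g = 3 / 2 := by
    have : mu1 a b g = 1 / 2 := by linarith
    unfold mu1 at this
    linarith
  have k1 := min_le_right a b
  have k2 := min_le_left a b
  have k3 := min_le_right a g
  have k4 := min_le_left a g
  have k5 := min_le_right b g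
  have k6 := min_le_left b g
  simp only [mul_eq_zero, sub_eq_zero] at hp0 hq0
  rcases hp0 with (h | h) | h <;> rcases hq0 with (h' | h') | h' <;> linarith

lemma half_lt_muMin : 1 / 2 < muMin := by
  let f : ℝ × ℝ × ℝ → ℝ := fun p => max (mu1 p.1 p.2.1 p.2.2) (mu2 p.1 p.2.1 p.2.2)
  let K : Set (ℝ × ℝ × ℝ) := Set.Icc (0 : ℝ) 1 ×ˢ Set.Icc (0 : ℝ) 1 ×ˢ Set.Icc (0 : ℝ) 1
  have hK : IsCompact K := isCompact_Icc.prod (isCompact_Icc.prod isCompact_Icc)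
  have hne : K.Nonempty := ⟨(0, 0, 0), by simp [K]⟩
  have hf : Continuous f := by
    unfold f mu1 mu2
    fun_prop
  have himage : muMin = sInf (f '' K) := by
    unfold muMin
    congr 1
    ext x
    constructor
    · rintro ⟨a, ha, b, hb, g, hg, rfl⟩
      exact ⟨(a, b, g), ⟨ha, hb, hg⟩, rfl⟩
    · rintro ⟨⟨a, b, g⟩, ⟨ha, hb, hg⟩, rfl⟩
      exact ⟨a, ha, b, hb, g, hg, rfl⟩
  obtain ⟨⟨a, b, g⟩, ⟨ha, hb, hg⟩, h⟩ := (hK.image hf).sInf_mem (hne.image f)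
  rw [himage, ← h]
  exact half_lt_max_mu1_mu2 ha hb hg

lemma tendsto_quadratic_div_cubic (A B C E : ℝ) {D : ℝ} (hD : 0 < D) :
    Tendsto (fun m : ℕ => (A * (m : ℝ) ^ 2 + B * (m : ℝ) + C) / ((m : ℝ) ^ 2 * (D * (m : ℝ) + E)))
      atTop (𝓝 0) := by
  have hm : Tendsto (fun m : ℕ => (m : ℝ)) atTop atTop := tendsto_natCast_atTop_atTop
  have hi : Tendsto (fun m : ℕ => (m : ℝ)⁻¹) atTop (𝓝 0) := tendsto_inv_atTop_zero.comp hm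
  have hd : Tendsto (fun m : ℕ => (D * (m : ℝ) + E)⁻¹) atTop (𝓝 0) :=
    tendsto_inv_atTop_zero.comp (tendsto_atTop_add_const_right _ _ (hm.const_mul_atTop hD))
  have h := (((hi.const_mul B).const_add A).add ((hi.pow 2).const_mul C)).mul hd
  rw [mul_zero] at h
  refine h.congr' ?_
  filter_upwards [eventually_gt_atTop 0] with m hm0
  have : (m : ℝ) ≠ 0 := by positivity
  rw [div_mul_eq_div_div, div_eq_mul_inv _ (D * (m : ℝ) + E)]
  congr 1
  field_simp

lemma tendsto_Lminus (k : ℕ) :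
    Tendsto (Lminus k) atTop (𝓝 (max (9 / ((k : ℝ) + 1)) 0)) := by
  have h1 := (tendsto_quadratic_div_cubic (6 * (k : ℝ) - 2) (-(9 * (k : ℝ) ^ 2 + 9))
    (3 * (k : ℝ) ^ 3 + 9 * (k : ℝ) + 6) (-(3 * k) - 2) three_pos).const_sub (9 / ((k : ℝ) + 1))
  have h2 := tendsto_quadratic_div_cubic 2 9 (-6) (-2) three_pos
  rw [sub_zero] at h1
  refine (h1.max h2).congr fun m => ?_
  unfold Lminus
  congr 1
  ring_nf

lemma tendsto_Lplus (k : ℕ) :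
    Tendsto (Lplus k) atTop (𝓝 (min (2 * muMin - 1) ((2 * muMin - 1) / 3))) := by
  have h1 := (tendsto_quadratic_div_cubic (2 * ((2 * muMin - 1) - 9 * (k : ℝ) - 8)) (-9) 6 (-2)
    three_pos).const_add (2 * muMin - 1)
  have h2 := (tendsto_quadratic_div_cubic (2 * ((2 * muMin - 1) - 24)) (-27) 18 (-6)
    (D := 27) (by norm_num)).const_add ((2 * muMin - 1) / 3)
  rw [add_zero] at h1 h2
  refine (h1.min h2).congr fun m => ?_
  unfold Lplus
  congr 1 <;> ring_nf

/-- **Existence of admissible parameters.** There exist `ε > 0` and positive integers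
`k ≤ m̄ − 1` such that `L⁻_{k,m} ≤ ε < L⁺_{k,m}` for every integer `m > m̄`. -/
theorem exists_eps_k_mbar :
    ∃ ε : ℝ, 0 < ε ∧ ∃ k mbar : ℕ, 0 < k ∧ 0 < mbar ∧ k ≤ mbar - 1 ∧
      ∀ m : ℕ, mbar < m → Lminus k m ≤ ε ∧ ε < Lplus k m := by
  have hmu := half_lt_muMin
  set d := 2 * muMin - 1 with hd
  have hd0 : 0 < d := by linarith
  obtain ⟨n, hn⟩ := exists_nat_gt (54 / d)
  have hk : 9 / (((n + 1 : ℕ) : ℝ) + 1) < d / 6 := by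
    rw [div_lt_iff₀ hd0] at hn
    rw [div_lt_iff₀ (by positivity)]
    push_cast
    linarith
  have hlower := (tendsto_Lminus (n + 1)).eventually_lt_const (max_lt hk (by positivity))
  have hupper := (tendsto_Lplus (n + 1)).eventually_const_lt
    (u := d / 6) (lt_min (by linarith) (by linarith))
  obtain ⟨M, hM⟩ := eventually_atTop.1 (hlower.and hupper)
  refine ⟨d / 6, by positivity, n + 1, M + n + 2, by omega, by omega, by omega, fun m hm => ?_⟩
  obtain ⟨h1, h2⟩ := hM m (by omega)
  exact ⟨h1.le, h2⟩
end
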